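/- arXiv:1111.2850 — 2 statements merged into one kernel-verified Lean document; each statement's English description precedes it below -/
import Mathlib

section
/- Lower bound for the counterexample family (key step in the sharpness proof): for k ≥ 1 let φ_k be the Schwartz function on ℝ³ whose Fourier transform is φ̂_k(ξ,η,μ) = δ_{-2k}(ξ) δ_k(η) δ_k(μ). Then (i) for every s ∈ ℝ there exist c₁,c₂>0 such that c₁ 2^{ks} ≤ ‖φ_k‖_{H^s} ≤ c₂ 2^{ks} for all k ≥ 1, and (ii) for every α ≥ 0 and T ∈ (0,1) there exist c>0 and k₀ such that for all k ≥ k₀, ( ∫_ℝ ( sup_{(y,z)∈ℝ², t∈[0,T]} t^α |U(t)φ_k(x,y,z)| )² dx )^{1/2} ≥ c 2^k. -/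
open MeasureTheory Real Filter
open scoped ENNReal

noncomputable section

/-- Euclidean dot product on ℝ³ (realized as ℝ × ℝ × ℝ). -/
def dot3 (a b : ℝ × ℝ × ℝ) : ℝ := a.1 * b.1 + a.2.1 * b.2.1 + a.2.2 * b.2.2

/-- Euclidean norm on ℝ³. -/
def en3 (ξ : ℝ × ℝ × ℝ) : ℝ := Real.sqrt (dot3 ξ ξ)

/-- The Zakharov–Kuznetsov dispersion relation ω(ξ,η,μ) = ξ(ξ²+η²+μ²). -/
def omega3 (ξ : ℝ × ℝ × ℝ) : ℝ := ξ.1 * (ξ.1 ^ 2 + ξ.2.1 ^ 2 + ξ.2.2 ^ 2)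

/-- Fourier transform on ℝ³, with normalization (2π)⁻³ ∫ e^{-i x·ξ} φ(x) dx. -/
def FT3 (φ : ℝ × ℝ × ℝ → ℂ) (ξ : ℝ × ℝ × ℝ) : ℂ :=
  ((((2 * π) ^ 3)⁻¹ : ℝ) : ℂ) * ∫ x : ℝ × ℝ × ℝ, Complex.exp (-Complex.I * (dot3 x ξ : ℂ)) * φ x

/-- Inverse Fourier transform on ℝ³: ∫ e^{i x·ξ} g(ξ) dξ. -/
def invFT3 (g : ℝ × ℝ × ℝ → ℂ) (x : ℝ × ℝ × ℝ) : ℂ :=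
  ∫ ξ : ℝ × ℝ × ℝ, Complex.exp (Complex.I * (dot3 x ξ : ℂ)) * g ξ

/-- The free Zakharov–Kuznetsov evolution U(t)φ(x̄) = ∫ e^{i(x̄·ξ̄ + tω(ξ̄))} φ̂(ξ̄) dξ̄. -/
def U3 (φ : ℝ × ℝ × ℝ → ℂ) (t : ℝ) (x : ℝ × ℝ × ℝ) : ℂ :=
  ∫ ξ : ℝ × ℝ × ℝ, Complex.exp (Complex.I * ((dot3 x ξ + t * omega3 ξ : ℝ) : ℂ)) * FT3 φ ξ

/-- L² norm on ℝ³. -/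
def L2norm3 (φ : ℝ × ℝ × ℝ → ℂ) : ℝ := Real.sqrt (∫ x : ℝ × ℝ × ℝ, ‖φ x‖ ^ 2)

/-- j-th coordinate of a point of ℝ³. -/
def coord3 (j : Fin 3) (ξ : ℝ × ℝ × ℝ) : ℝ := ![ξ.1, ξ.2.1, ξ.2.2] j

/-- Littlewood–Paley ring cutoff δ_k(ξ̄) = p(2^{-k-1}ξ̄) − p(2^{-k}ξ̄) on ℝ³. -/
def delta3 (p : ℝ × ℝ × ℝ → ℝ) (k : ℤ) (ξ : ℝ × ℝ × ℝ) : ℝ :=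
  p ((2:ℝ) ^ (-k-1) • ξ) - p ((2:ℝ) ^ (-k) • ξ)

/-- 1D rescaled cutoff p_k(ξ) = p(2^{-k}ξ). -/
def pk1 (p : ℝ → ℝ) (k : ℤ) (ξ : ℝ) : ℝ := p ((2:ℝ) ^ (-k) * ξ)

/-- 1D ring cutoff δ_k(ξ) = p(2^{-k-1}ξ) − p(2^{-k}ξ). -/
def dk1 (p : ℝ → ℝ) (k : ℤ) (ξ : ℝ) : ℝ := p ((2:ℝ) ^ (-k-1) * ξ) - p ((2:ℝ) ^ (-k) * ξ)

/-- Oscillatory integral I with three 1D symbols: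
I(t,x̄) = ∫ e^{i(x̄·ξ̄+tω(ξ̄))} ψ₁(ξ)ψ₂(η)ψ₃(μ) dξ̄. -/
def oscI (ψ₁ ψ₂ ψ₃ : ℝ → ℝ) (t : ℝ) (x : ℝ × ℝ × ℝ) : ℂ :=
  ∫ ξ : ℝ × ℝ × ℝ, Complex.exp (Complex.I * ((dot3 x ξ + t * omega3 ξ : ℝ) : ℂ)) *
    ((ψ₁ ξ.1 * ψ₂ ξ.2.1 * ψ₃ ξ.2.2 : ℝ) : ℂ)

/-- The counterexample family: U(t)φ_k where φ̂_k(ξ,η,μ) = δ_{-2k}(ξ) δ_k(η) δ_k(μ). -/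
def Uphik (p : ℝ → ℝ) (k : ℕ) (t : ℝ) (x : ℝ × ℝ × ℝ) : ℂ :=
  oscI (dk1 p (-(2 * (k:ℤ)))) (dk1 p (k:ℤ)) (dk1 p (k:ℤ)) t x

/-- The H^s norm of φ_k computed on the Fourier side. -/
def HsNormPhik (p : ℝ → ℝ) (s : ℝ) (k : ℕ) : ℝ :=
  Real.sqrt (∫ ξ : ℝ × ℝ × ℝ, (1 + dot3 ξ ξ) ^ s *
    (dk1 p (-(2 * (k:ℤ))) ξ.1 * dk1 p (k:ℤ) ξ.2.1 * dk1 p (k:ℤ) ξ.2.2) ^ 2)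

/-! ### Integrals of tensor products -/

lemma integrable_tensor {f g h : ℝ → ℝ} (hf : Integrable f) (hg : Integrable g)
    (hh : Integrable h) :
    Integrable (fun ξ : ℝ × ℝ × ℝ => f ξ.1 * g ξ.2.1 * h ξ.2.2) := by
  simp only [mul_assoc]
  exact hf.mul_prod (hg.mul_prod hh)

lemma integral_tensor (f g h : ℝ → ℝ) :
    ∫ ξ : ℝ × ℝ × ℝ, f ξ.1 * g ξ.2.1 * h ξ.2.2 = (∫ u, f u) * (∫ u, g u) * ∫ u, h u := by
  simp only [mul_assoc]
  rw [← integral_prod_mul g h]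
  exact integral_prod_mul f (fun w : ℝ × ℝ => g w.1 * h w.2)

/-! ### The oscillatory integral `oscI` -/

lemma norm_exp_I_mul_ofReal_mul (θ a : ℝ) :
    ‖Complex.exp (Complex.I * (θ : ℂ)) * (a : ℂ)‖ = |a| := by
  rw [norm_mul, mul_comm Complex.I, Complex.norm_exp_ofReal_mul_I, one_mul, Complex.norm_real,
    Real.norm_eq_abs]

lemma norm_oscI_le (ψ₁ ψ₂ ψ₃ : ℝ → ℝ) (t : ℝ) (x : ℝ × ℝ × ℝ) :
    ‖oscI ψ₁ ψ₂ ψ₃ t x‖ ≤ (∫ u, |ψ₁ u|) * (∫ u, |ψ₂ u|) * ∫ u, |ψ₃ u| := by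
  refine (norm_integral_le_integral_norm _).trans (le_of_eq ?_)
  simp only [norm_exp_I_mul_ofReal_mul, abs_mul]
  exact integral_tensor (fun u => |ψ₁ u|) (fun u => |ψ₂ u|) (fun u => |ψ₃ u|)

lemma continuous_omega3 : Continuous omega3 := by
  unfold omega3; fun_prop

lemma continuous_dot3 : Continuous fun q : (ℝ × ℝ × ℝ) × (ℝ × ℝ × ℝ) => dot3 q.1 q.2 := by
  unfold dot3; fun_prop

lemma continuous_oscI_phase (t : ℝ) (x : ℝ × ℝ × ℝ) :
    Continuous fun ξ : ℝ × ℝ × ℝ => dot3 x ξ + t * omega3 ξ :=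
  (continuous_dot3.comp (continuous_const.prodMk continuous_id)).add
    (continuous_const.mul continuous_omega3)

section Oscillatory

variable {ψ₁ ψ₂ ψ₃ : ℝ → ℝ}

lemma integrable_oscI_integrand (h₁ : Continuous ψ₁) (h₁' : HasCompactSupport ψ₁)
    (h₂ : Continuous ψ₂) (h₂' : HasCompactSupport ψ₂) (h₃ : Continuous ψ₃)
    (h₃' : HasCompactSupport ψ₃) (t : ℝ) (x : ℝ × ℝ × ℝ) :
    Integrable fun ξ : ℝ × ℝ × ℝ =>
      Complex.exp (Complex.I * ((dot3 x ξ + t * omega3 ξ : ℝ) : ℂ)) *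
        ((ψ₁ ξ.1 * ψ₂ ξ.2.1 * ψ₃ ξ.2.2 : ℝ) : ℂ) := by
  refine (integrable_tensor (h₁.integrable_of_hasCompactSupport h₁')
    (h₂.integrable_of_hasCompactSupport h₂') (h₃.integrable_of_hasCompactSupport h₃')).mono
    (Continuous.aestronglyMeasurable ?_) (Eventually.of_forall fun ξ => ?_)
  · have := continuous_oscI_phase t x
    fun_prop
  · rw [norm_exp_I_mul_ofReal_mul, Real.norm_eq_abs]

lemma continuous_oscI (h₁ : Continuous ψ₁) (h₁' : HasCompactSupport ψ₁)
    (h₂ : Continuous ψ₂) (h₂' : HasCompactSupport ψ₂) (h₃ : Continuous ψ₃)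
    (h₃' : HasCompactSupport ψ₃) (t : ℝ) :
    Continuous fun x : ℝ × ℝ × ℝ => oscI ψ₁ ψ₂ ψ₃ t x := by
  unfold oscI
  refine continuous_of_dominated
    (bound := fun ξ => |ψ₁ ξ.1 * ψ₂ ξ.2.1 * ψ₃ ξ.2.2|)
    (fun x => (integrable_oscI_integrand h₁ h₁' h₂ h₂' h₃ h₃' t x).aestronglyMeasurable)
    (fun x => Eventually.of_forall fun ξ => (norm_exp_I_mul_ofReal_mul _ _).le)
    (integrable_tensor (h₁.integrable_of_hasCompactSupport h₁')
      (h₂.integrable_of_hasCompactSupport h₂') (h₃.integrable_of_hasCompactSupport h₃')).abs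
    (Eventually.of_forall fun ξ => ?_)
  have : Continuous fun x : ℝ × ℝ × ℝ => dot3 x ξ :=
    continuous_dot3.comp (continuous_id.prodMk continuous_const)
  fun_prop

/-- If the phase is at most `ε` on the support of the amplitude, then `oscI` is close to the
integral of the amplitude. -/
lemma norm_oscI_sub_le (h₁ : Continuous ψ₁) (h₁' : HasCompactSupport ψ₁)
    (h₂ : Continuous ψ₂) (h₂' : HasCompactSupport ψ₂) (h₃ : Continuous ψ₃)
    (h₃' : HasCompactSupport ψ₃) {t ε : ℝ} {x : ℝ × ℝ × ℝ}
    (hε : ∀ ξ : ℝ × ℝ × ℝ, ψ₁ ξ.1 ≠ 0 → ψ₂ ξ.2.1 ≠ 0 → ψ₃ ξ.2.2 ≠ 0 →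
      |dot3 x ξ + t * omega3 ξ| ≤ ε) :
    ‖oscI ψ₁ ψ₂ ψ₃ t x - (((∫ u, ψ₁ u) * (∫ u, ψ₂ u) * ∫ u, ψ₃ u : ℝ) : ℂ)‖ ≤
      ε * ((∫ u, |ψ₁ u|) * (∫ u, |ψ₂ u|) * ∫ u, |ψ₃ u|) := by
  have hint := integrable_tensor (h₁.integrable_of_hasCompactSupport h₁')
    (h₂.integrable_of_hasCompactSupport h₂') (h₃.integrable_of_hasCompactSupport h₃')
  have hintC : Integrable fun ξ : ℝ × ℝ × ℝ => ((ψ₁ ξ.1 * ψ₂ ξ.2.1 * ψ₃ ξ.2.2 : ℝ) : ℂ) :=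
    hint.ofReal
  rw [← integral_tensor ψ₁ ψ₂ ψ₃, ← integral_tensor (fun u => |ψ₁ u|) (fun u => |ψ₂ u|)
    (fun u => |ψ₃ u|), ← integral_const_mul, ← integral_complex_ofReal, oscI,
    ← integral_sub (integrable_oscI_integrand h₁ h₁' h₂ h₂' h₃ h₃' t x) hintC]
  simp only [← abs_mul]
  refine norm_integral_le_of_norm_le (hint.abs.const_mul ε) (Eventually.of_forall fun ξ => ?_)
  rw [← sub_one_mul, norm_mul, Complex.norm_real, Real.norm_eq_abs]
  by_cases h : ψ₁ ξ.1 * ψ₂ ξ.2.1 * ψ₃ ξ.2.2 = 0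
  · simp [h]
  · have h' := h
    simp only [mul_ne_zero_iff, ← ne_eq] at h'
    gcongr
    exact Real.norm_exp_I_mul_ofReal_sub_one_le.trans (hε ξ h'.1.1 h'.1.2 h'.2)

set_option maxHeartbeats 1000000 in
/-- One-dimensional decay estimate obtained by a single integration by parts. -/
lemma abs_mul_norm_integral_exp_le {ψ : ℝ → ℝ} (hψ : ContDiff ℝ 1 ψ) (hψ' : HasCompactSupport ψ)
    {t : ℝ} (ht : |t| ≤ 1) {q : ℝ} (hq : 0 ≤ q) (x : ℝ) :
    |x| * ‖∫ ξ : ℝ, Complex.exp (Complex.I * ((x * ξ + t * (ξ * (ξ ^ 2 + q)) : ℝ) : ℂ)) *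
      (ψ ξ : ℂ)‖ ≤ (∫ ξ, (3 * ξ ^ 2 * |ψ ξ| + |deriv ψ ξ|)) + q * ∫ ξ, |ψ ξ| := by
  have hψc := hψ.continuous
  have hdc : Continuous (deriv ψ) := hψ.continuous_deriv le_rfl
  have hds : HasCompactSupport (deriv ψ) := hψ'.deriv
  set u : ℝ → ℂ := fun ξ => Complex.exp (Complex.I * ((x * ξ : ℝ) : ℂ)) with hu
  set e : ℝ → ℂ := fun ξ => Complex.exp (Complex.I * ((t * (ξ * (ξ ^ 2 + q)) : ℝ) : ℂ)) with he
  set v : ℝ → ℂ := fun ξ => e ξ * (ψ ξ : ℂ) with hv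
  set v' : ℝ → ℂ := fun ξ =>
    e ξ * (Complex.I * ((t * (3 * ξ ^ 2 + q) : ℝ) : ℂ)) * (ψ ξ : ℂ) +
      e ξ * ((deriv ψ ξ : ℝ) : ℂ) with hv'
  have hud : ∀ ξ, HasDerivAt u (u ξ * (Complex.I * (x : ℂ))) ξ := by
    intro ξ
    have h : HasDerivAt (fun ξ : ℝ => x * ξ) x ξ := by
      simpa using (hasDerivAt_id ξ).const_mul x
    exact (h.ofReal_comp.const_mul Complex.I).cexp
  have hed : ∀ ξ, HasDerivAt e (e ξ * (Complex.I * ((t * (3 * ξ ^ 2 + q) : ℝ) : ℂ))) ξ := by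
    intro ξ
    have h : HasDerivAt (fun ξ : ℝ => t * (ξ * (ξ ^ 2 + q))) (t * (3 * ξ ^ 2 + q)) ξ := by
      refine (((hasDerivAt_id' ξ).mul
        (((hasDerivAt_id' ξ).fun_pow 2).add_const q)).const_mul t).congr_deriv ?_
      push_cast
      ring
    exact (h.ofReal_comp.const_mul Complex.I).cexp
  have hvd : ∀ ξ, HasDerivAt v (v' ξ) ξ := fun ξ =>
    (hed ξ).mul ((hψ.differentiable one_ne_zero ξ).hasDerivAt.ofReal_comp)
  have huc : Continuous u := by fun_prop
  have hec : Continuous e := by fun_prop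
  have hψC : HasCompactSupport fun ξ => (ψ ξ : ℂ) := hψ'.comp_left Complex.ofReal_zero
  have hdC : HasCompactSupport fun ξ => ((deriv ψ ξ : ℝ) : ℂ) := hds.comp_left Complex.ofReal_zero
  have hvc : Continuous v := by fun_prop
  have hvs : HasCompactSupport v := hψC.mul_left
  have hvc' : Continuous v' := by fun_prop
  have hvs' : HasCompactSupport v' := hψC.mul_left.add hdC.mul_left
  have ibp := integral_mul_deriv_eq_deriv_mul_of_integrable (u := u) (v := v)
    (u' := fun ξ => u ξ * (Complex.I * (x : ℂ))) (v' := v') (fun ξ _ => hud ξ) (fun ξ _ => hvd ξ)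
    ((huc.mul hvc').integrable_of_hasCompactSupport hvs'.mul_left)
    (((huc.mul continuous_const).mul hvc).integrable_of_hasCompactSupport hvs.mul_left)
    ((huc.mul hvc).integrable_of_hasCompactSupport hvs.mul_left)
  have key : |x| * ‖∫ ξ : ℝ, Complex.exp (Complex.I * ((x * ξ + t * (ξ * (ξ ^ 2 + q)) : ℝ) : ℂ)) *
      (ψ ξ : ℂ)‖ = ‖∫ ξ, u ξ * v' ξ‖ := by
    have h : ∀ ξ, u ξ * (Complex.I * (x : ℂ)) * v ξ = (Complex.I * (x : ℂ)) *
        (Complex.exp (Complex.I * ((x * ξ + t * (ξ * (ξ ^ 2 + q)) : ℝ) : ℂ)) * (ψ ξ : ℂ)) := by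
      intro ξ
      simp only [hu, hv, he]
      rw [Complex.ofReal_add, mul_add Complex.I, Complex.exp_add]
      ring
    rw [ibp, norm_neg, integral_congr_ae (Eventually.of_forall h), integral_const_mul, norm_mul,
      norm_mul, Complex.norm_I, one_mul, Complex.norm_real, Real.norm_eq_abs]
  have hψa : HasCompactSupport fun ξ => |ψ ξ| := hψ'.comp_left abs_zero
  have hda : HasCompactSupport fun ξ => |deriv ψ ξ| := hds.comp_left abs_zero
  have i₁ : Integrable fun ξ => 3 * ξ ^ 2 * |ψ ξ| + |deriv ψ ξ| :=
    Continuous.integrable_of_hasCompactSupport (by fun_prop) (hψa.mul_left.add hda)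
  have i₂ : Integrable fun ξ => q * |ψ ξ| :=
    Continuous.integrable_of_hasCompactSupport (by fun_prop) hψa.mul_left
  rw [key, ← integral_const_mul, ← integral_add i₁ i₂]
  refine norm_integral_le_of_norm_le (i₁.add i₂) (Eventually.of_forall fun ξ => ?_)
  have hun : ‖u ξ‖ = 1 := by
    simp only [hu]; rw [mul_comm, Complex.norm_exp_ofReal_mul_I]
  have hen : ‖e ξ‖ = 1 := by
    simp only [he]; rw [mul_comm, Complex.norm_exp_ofReal_mul_I]
  rw [norm_mul, hun, one_mul]
  refine (norm_add_le _ _).trans ?_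
  simp only [norm_mul, hen, Complex.norm_I, Complex.norm_real, Real.norm_eq_abs, one_mul]
  have hq3 : |3 * ξ ^ 2 + q| = 3 * ξ ^ 2 + q := abs_of_nonneg (by positivity)
  rw [hq3]
  have : |t| * (3 * ξ ^ 2 + q) * |ψ ξ| ≤ 1 * (3 * ξ ^ 2 + q) * |ψ ξ| := by gcongr
  linarith

/-- Decay of `oscI` in the first spatial variable, uniformly in the others and in `|t| ≤ 1`. -/
lemma exists_abs_mul_norm_oscI_le (h₁ : ContDiff ℝ 1 ψ₁) (h₁' : HasCompactSupport ψ₁)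
    (h₂ : Continuous ψ₂) (h₂' : HasCompactSupport ψ₂) (h₃ : Continuous ψ₃)
    (h₃' : HasCompactSupport ψ₃) :
    ∃ C : ℝ, ∀ t x y z : ℝ, |t| ≤ 1 → |x| * ‖oscI ψ₁ ψ₂ ψ₃ t (x, y, z)‖ ≤ C := by
  set A : ℝ := ∫ ξ, (3 * ξ ^ 2 * |ψ₁ ξ| + |deriv ψ₁ ξ|)
  set B : ℝ := ∫ ξ, |ψ₁ ξ|
  set G : ℝ × ℝ → ℝ := fun w => |ψ₂ w.1| * |ψ₃ w.2| * A + (w.1 ^ 2 * |ψ₂ w.1|) * |ψ₃ w.2| * B +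
    |ψ₂ w.1| * (w.2 ^ 2 * |ψ₃ w.2|) * B with hG
  have a₂ : HasCompactSupport fun ξ => |ψ₂ ξ| := h₂'.comp_left abs_zero
  have a₃ : HasCompactSupport fun ξ => |ψ₃ ξ| := h₃'.comp_left abs_zero
  have i₂ : Integrable fun ξ => |ψ₂ ξ| := h₂.abs.integrable_of_hasCompactSupport a₂
  have i₃ : Integrable fun ξ => |ψ₃ ξ| := h₃.abs.integrable_of_hasCompactSupport a₃
  have j₂ : Integrable fun ξ => ξ ^ 2 * |ψ₂ ξ| :=
    Continuous.integrable_of_hasCompactSupport (by fun_prop) a₂.mul_left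
  have j₃ : Integrable fun ξ => ξ ^ 2 * |ψ₃ ξ| :=
    Continuous.integrable_of_hasCompactSupport (by fun_prop) a₃.mul_left
  have iG : Integrable G :=
    (((i₂.mul_prod i₃).mul_const A).add ((j₂.mul_prod i₃).mul_const B)).add
      ((i₂.mul_prod j₃).mul_const B)
  refine ⟨∫ w, G w, fun t x y z ht => ?_⟩
  have hint := integrable_oscI_integrand h₁.continuous h₁' h₂ h₂' h₃ h₃' t (x, y, z)
  have hsymm : oscI ψ₁ ψ₂ ψ₃ t (x, y, z) = ∫ w : ℝ × ℝ, ∫ ξ : ℝ,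
      Complex.exp (Complex.I * ((dot3 (x, y, z) (ξ, w) + t * omega3 (ξ, w) : ℝ) : ℂ)) *
        ((ψ₁ ξ * ψ₂ w.1 * ψ₃ w.2 : ℝ) : ℂ) := integral_prod_symm _ hint
  have hx : ∀ c : ℂ, |x| * ‖c‖ = ‖(x : ℂ) * c‖ := fun c => by
    rw [norm_mul, Complex.norm_real, Real.norm_eq_abs]
  rw [hsymm, hx, ← integral_const_mul]
  refine norm_integral_le_of_norm_le iG (Eventually.of_forall fun w => ?_)
  have hfac : ∀ ξ : ℝ,
      Complex.exp (Complex.I * ((dot3 (x, y, z) (ξ, w) + t * omega3 (ξ, w) : ℝ) : ℂ)) *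
        ((ψ₁ ξ * ψ₂ w.1 * ψ₃ w.2 : ℝ) : ℂ) =
      (Complex.exp (Complex.I * ((y * w.1 + z * w.2 : ℝ) : ℂ)) * ((ψ₂ w.1 * ψ₃ w.2 : ℝ) : ℂ)) *
      (Complex.exp (Complex.I * ((x * ξ + t * (ξ * (ξ ^ 2 + (w.1 ^ 2 + w.2 ^ 2))) : ℝ) : ℂ)) *
        (ψ₁ ξ : ℂ)) := by
    intro ξ
    have : dot3 (x, y, z) (ξ, w) + t * omega3 (ξ, w) =
        (y * w.1 + z * w.2) + (x * ξ + t * (ξ * (ξ ^ 2 + (w.1 ^ 2 + w.2 ^ 2)))) := by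
      simp only [dot3, omega3]; ring
    rw [this, Complex.ofReal_add, mul_add, Complex.exp_add]
    push_cast
    ring
  rw [integral_congr_ae (Eventually.of_forall hfac), integral_const_mul, ← hx, norm_mul,
    norm_exp_I_mul_ofReal_mul, abs_mul]
  have h1 := abs_mul_norm_integral_exp_le h₁ h₁' ht (q := w.1 ^ 2 + w.2 ^ 2) (by positivity) x
  calc _ = |ψ₂ w.1| * |ψ₃ w.2| * (|x| * ‖∫ ξ : ℝ, Complex.exp (Complex.I *
        ((x * ξ + t * (ξ * (ξ ^ 2 + (w.1 ^ 2 + w.2 ^ 2))) : ℝ) : ℂ)) * (ψ₁ ξ : ℂ)‖) := by ring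
    _ ≤ |ψ₂ w.1| * |ψ₃ w.2| * (A + (w.1 ^ 2 + w.2 ^ 2) * B) := by gcongr
    _ = G w := by simp only [hG]; ring

end Oscillatory

/-! ### The ring cutoff `dk1` -/

lemma dk1_eq_dk1_zero (p : ℝ → ℝ) (k : ℤ) (ξ : ℝ) :
    dk1 p k ξ = dk1 p 0 ((2 : ℝ) ^ (-k) * ξ) := by
  simp only [dk1, neg_zero, zero_sub, zpow_zero, one_mul, ← mul_assoc]
  rw [← zpow_add₀ (two_ne_zero' ℝ)]
  ring_nf

lemma integral_comp_dk1 (p F : ℝ → ℝ) (k : ℤ) :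
    ∫ ξ, F (dk1 p k ξ) = (2 : ℝ) ^ k * ∫ ξ, F (dk1 p 0 ξ) := by
  simp only [dk1_eq_dk1_zero p k]
  rw [Measure.integral_comp_mul_left (fun ξ => F (dk1 p 0 ξ)), zpow_neg, inv_inv,
    abs_of_pos (by positivity), smul_eq_mul]

lemma integral_comp_dk1_triple (p F : ℝ → ℝ) (k : ℕ) :
    (∫ u, F (dk1 p (-(2 * (k : ℤ))) u)) * (∫ u, F (dk1 p (k : ℤ) u)) * ∫ u, F (dk1 p (k : ℤ) u) =
      (∫ u, F (dk1 p 0 u)) ^ 3 := by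
  rw [integral_comp_dk1 p F, integral_comp_dk1 p F k]
  have : (2 : ℝ) ^ (-(2 * (k : ℤ))) * 2 ^ (k : ℤ) * 2 ^ (k : ℤ) = 1 := by
    rw [← zpow_add₀ two_ne_zero, ← zpow_add₀ two_ne_zero]
    ring_nf
    exact zpow_zero _
  linear_combination (∫ u, F (dk1 p 0 u)) ^ 3 * this

section Cutoff

variable {p : ℝ → ℝ}

lemma contDiff_dk1 (hp : ContDiff ℝ (⊤ : ℕ∞) p) (k : ℤ) : ContDiff ℝ 1 (dk1 p k) := by
  have hp' : ContDiff ℝ 1 p := hp.of_le (by exact_mod_cast le_top)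
  unfold dk1
  fun_prop

lemma le_abs_and_abs_le_of_dk1_ne_zero (hp_one : ∀ ξ : ℝ, |ξ| ≤ 1 → p ξ = 1)
    (hp_zero : ∀ ξ : ℝ, 2 ≤ |ξ| → p ξ = 0) {k : ℤ} {ξ : ℝ} (h : dk1 p k ξ ≠ 0) :
    (2 : ℝ) ^ k ≤ |ξ| ∧ |ξ| ≤ 4 * (2 : ℝ) ^ k := by
  have hk : (0 : ℝ) < 2 ^ k := by positivity
  have e₀ : |(2 : ℝ) ^ (-k) * ξ| = |ξ| / 2 ^ k := by
    rw [abs_mul, zpow_neg, abs_of_pos (inv_pos.2 hk), div_eq_inv_mul]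
  have e₁ : |(2 : ℝ) ^ (-k - 1) * ξ| = |ξ| / 2 ^ k / 2 := by
    rw [zpow_sub_one₀ two_ne_zero, mul_right_comm, abs_mul, e₀,
      abs_of_pos (show (0 : ℝ) < 2⁻¹ by norm_num)]
    ring
  constructor <;> by_contra! hlt <;> apply h <;> unfold dk1
  · have : |ξ| / 2 ^ k ≤ 1 := (div_le_one hk).2 hlt.le
    rw [hp_one _ (e₀.trans_le this), hp_one _ (e₁.trans_le (by linarith)), sub_self]
  · have : 4 ≤ |ξ| / 2 ^ k := (le_div_iff₀ hk).2 hlt.le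
    rw [hp_zero _ (le_trans (by linarith) e₀.ge), hp_zero _ (le_trans (by linarith) e₁.ge),
      sub_self]

lemma hasCompactSupport_dk1 (hp_one : ∀ ξ : ℝ, |ξ| ≤ 1 → p ξ = 1)
    (hp_zero : ∀ ξ : ℝ, 2 ≤ |ξ| → p ξ = 0) (k : ℤ) : HasCompactSupport (dk1 p k) := by
  refine HasCompactSupport.intro (K := Metric.closedBall 0 (4 * (2 : ℝ) ^ k))
    (isCompact_closedBall _ _) fun ξ hξ => ?_
  by_contra h
  apply hξ
  simpa using (le_abs_and_abs_le_of_dk1_ne_zero hp_one hp_zero h).2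

lemma hasCompactSupport_dk1_sq (hp_one : ∀ ξ : ℝ, |ξ| ≤ 1 → p ξ = 1)
    (hp_zero : ∀ ξ : ℝ, 2 ≤ |ξ| → p ξ = 0) (k : ℤ) :
    HasCompactSupport fun ξ => dk1 p k ξ ^ 2 := by
  simp only [sq]
  exact (hasCompactSupport_dk1 hp_one hp_zero k).mul_left

lemma integral_dk1_zero_pos (hp_smooth : ContDiff ℝ (⊤ : ℕ∞) p) (hp_nonneg : ∀ ξ, 0 ≤ p ξ)
    (hp_one : ∀ ξ : ℝ, |ξ| ≤ 1 → p ξ = 1) (hp_zero : ∀ ξ : ℝ, 2 ≤ |ξ| → p ξ = 0) :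
    0 < ∫ ξ, dk1 p 0 ξ := by
  have hc : HasCompactSupport p := by
    refine HasCompactSupport.intro (K := Metric.closedBall 0 2)
      (isCompact_closedBall _ _) fun ξ hξ => hp_zero ξ ?_
    simp only [Metric.mem_closedBall, dist_zero_right, Real.norm_eq_abs, not_le] at hξ
    exact hξ.le
  have hi : Integrable p := hp_smooth.continuous.integrable_of_hasCompactSupport hc
  have hpos : 0 < ∫ ξ, p ξ :=
    hp_smooth.continuous.integral_pos_of_hasCompactSupport_nonneg_nonzero hc hp_nonneg
      (x := 0) (by rw [hp_one 0 (by simp)]; exact one_ne_zero)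
  have h : ∀ ξ, dk1 p 0 ξ = p (2⁻¹ * ξ) - p ξ := fun ξ => by
    simp [dk1]
  simp only [h]
  rw [integral_sub (hi.comp_mul_left' (by norm_num)) hi, Measure.integral_comp_mul_left]
  norm_num
  linarith

end Cutoff

section Family

variable {p : ℝ → ℝ}

lemma integral_abs_dk1_zero_pos (hp_smooth : ContDiff ℝ (⊤ : ℕ∞) p) (hp_nonneg : ∀ ξ, 0 ≤ p ξ)
    (hp_one : ∀ ξ : ℝ, |ξ| ≤ 1 → p ξ = 1) (hp_zero : ∀ ξ : ℝ, 2 ≤ |ξ| → p ξ = 0) :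
    0 < ∫ ξ, |dk1 p 0 ξ| :=
  (integral_dk1_zero_pos hp_smooth hp_nonneg hp_one hp_zero).trans_le
    ((le_abs_self _).trans (abs_integral_le_integral_abs))

lemma integral_dk1_zero_sq_pos (hp_smooth : ContDiff ℝ (⊤ : ℕ∞) p) (hp_nonneg : ∀ ξ, 0 ≤ p ξ)
    (hp_one : ∀ ξ : ℝ, |ξ| ≤ 1 → p ξ = 1) (hp_zero : ∀ ξ : ℝ, 2 ≤ |ξ| → p ξ = 0) :
    0 < ∫ ξ, dk1 p 0 ξ ^ 2 := by
  have hpos := integral_dk1_zero_pos hp_smooth hp_nonneg hp_one hp_zero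
  obtain ⟨ξ, hξ⟩ : ∃ ξ, dk1 p 0 ξ ≠ 0 := by
    by_contra! h
    simp [h] at hpos
  exact ((contDiff_dk1 hp_smooth 0).continuous.pow 2).integral_pos_of_hasCompactSupport_nonneg_nonzero
    (hasCompactSupport_dk1_sq hp_one hp_zero 0)
    (fun ξ => sq_nonneg _) (x := ξ) (pow_ne_zero 2 hξ)

/-- Location of the frequency support of `φ_k`, written with `N = 2 ^ k`. -/
lemma freq_bounds (hp_one : ∀ ξ : ℝ, |ξ| ≤ 1 → p ξ = 1)
    (hp_zero : ∀ ξ : ℝ, 2 ≤ |ξ| → p ξ = 0) {k : ℕ} {ξ : ℝ × ℝ × ℝ}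
    (h₁ : dk1 p (-(2 * (k : ℤ))) ξ.1 ≠ 0) (h₂ : dk1 p (k : ℤ) ξ.2.1 ≠ 0)
    (h₃ : dk1 p (k : ℤ) ξ.2.2 ≠ 0) :
    |ξ.1| * ((2 : ℝ) ^ k) ^ 2 ≤ 4 ∧ ((2 : ℝ) ^ k) ^ 2 ≤ ξ.2.1 ^ 2 ∧
      ξ.2.1 ^ 2 ≤ 16 * ((2 : ℝ) ^ k) ^ 2 ∧ ξ.2.2 ^ 2 ≤ 16 * ((2 : ℝ) ^ k) ^ 2 := by
  have b₁ := (le_abs_and_abs_le_of_dk1_ne_zero hp_one hp_zero h₁).2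
  have b₂ := le_abs_and_abs_le_of_dk1_ne_zero hp_one hp_zero h₂
  have b₃ := (le_abs_and_abs_le_of_dk1_ne_zero hp_one hp_zero h₃).2
  have hN : (0 : ℝ) < 2 ^ k := by positivity
  have e : (2 : ℝ) ^ (-(2 * (k : ℤ))) = (((2 : ℝ) ^ k) ^ 2)⁻¹ := by
    rw [zpow_neg, mul_comm, zpow_mul, zpow_natCast]
    norm_cast
  rw [e, ← div_eq_mul_inv, le_div_iff₀ (by positivity)] at b₁
  rw [zpow_natCast] at b₂ b₃
  refine ⟨b₁, ?_, ?_, ?_⟩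
  · rw [← sq_abs ξ.2.1]; gcongr; exact b₂.1
  · rw [← sq_abs ξ.2.1]; nlinarith [b₂.2, abs_nonneg ξ.2.1]
  · rw [← sq_abs ξ.2.2]; nlinarith [b₃, abs_nonneg ξ.2.2]

lemma rpow_mem_Icc_of_mem_Icc {r R : ℝ} (hr : 1 ≤ r) (hR : r ≤ R) (s : ℝ) :
    min 1 (R ^ s) ≤ r ^ s ∧ r ^ s ≤ max 1 (R ^ s) := by
  rcases le_total 0 s with hs | hs
  · exact ⟨(min_le_left _ _).trans (Real.one_le_rpow hr hs),
      (Real.rpow_le_rpow (by linarith) hR hs).trans (le_max_right _ _)⟩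
  · exact ⟨(min_le_right _ _).trans (Real.rpow_le_rpow_of_nonpos (by linarith) hR hs),
      (Real.rpow_le_one_of_one_le_of_nonpos hr hs).trans (le_max_left _ _)⟩

lemma sobolev_weight_bounds (hp_one : ∀ ξ : ℝ, |ξ| ≤ 1 → p ξ = 1)
    (hp_zero : ∀ ξ : ℝ, 2 ≤ |ξ| → p ξ = 0) (s : ℝ) {k : ℕ} {ξ : ℝ × ℝ × ℝ}
    (h₁ : dk1 p (-(2 * (k : ℤ))) ξ.1 ≠ 0) (h₂ : dk1 p (k : ℤ) ξ.2.1 ≠ 0)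
    (h₃ : dk1 p (k : ℤ) ξ.2.2 ≠ 0) :
    min 1 ((49 : ℝ) ^ s) * ((2 : ℝ) ^ ((k : ℝ) * s)) ^ 2 ≤ (1 + dot3 ξ ξ) ^ s ∧
      (1 + dot3 ξ ξ) ^ s ≤ max 1 ((49 : ℝ) ^ s) * ((2 : ℝ) ^ ((k : ℝ) * s)) ^ 2 := by
  obtain ⟨b₁, b₂, b₂', b₃⟩ := freq_bounds hp_one hp_zero h₁ h₂ h₃
  have hN : (1 : ℝ) ≤ 2 ^ k := one_le_pow₀ one_le_two
  have eP : ((2 : ℝ) ^ ((k : ℝ) * s)) ^ 2 = (((2 : ℝ) ^ k) ^ 2) ^ s := by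
    rw [Real.rpow_mul two_pos.le, Real.rpow_natCast, ← Real.rpow_natCast, ← Real.rpow_mul
      (by positivity), mul_comm, Real.rpow_mul (by positivity), Real.rpow_natCast]
  rw [eP]
  set N : ℝ := 2 ^ k
  have hN2 : 1 ≤ N ^ 2 := one_le_pow₀ hN
  have hx : ξ.1 ^ 2 ≤ 16 := by
    have : |ξ.1| ≤ 4 := by nlinarith [abs_nonneg ξ.1]
    nlinarith [sq_abs ξ.1, abs_nonneg ξ.1]
  have e : 1 + dot3 ξ ξ = (1 + dot3 ξ ξ) / N ^ 2 * N ^ 2 := by field_simp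
  have hlow : 1 ≤ (1 + dot3 ξ ξ) / N ^ 2 := by
    rw [le_div_iff₀ (by positivity)]
    unfold dot3
    nlinarith [sq_nonneg ξ.1, sq_nonneg ξ.2.2]
  have hup : (1 + dot3 ξ ξ) / N ^ 2 ≤ 49 := by
    rw [div_le_iff₀ (by positivity)]
    unfold dot3
    nlinarith
  obtain ⟨l, u⟩ := rpow_mem_Icc_of_mem_Icc hlow hup s
  rw [e, Real.mul_rpow (by linarith) (by positivity)]
  constructor <;> gcongr

/-- If the Sobolev weight lies between `m P²` and `M P²` on the support of the Fourier transform of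
`φ_k`, then the `H^s` norm of `φ_k` is comparable to `P`. -/
lemma HsNormPhik_bounds_of_weight (hp_smooth : ContDiff ℝ (⊤ : ℕ∞) p)
    (hp_one : ∀ ξ : ℝ, |ξ| ≤ 1 → p ξ = 1) (hp_zero : ∀ ξ : ℝ, 2 ≤ |ξ| → p ξ = 0)
    {s : ℝ} {k : ℕ} {m M P : ℝ} (hP : 0 ≤ P)
    (hw : ∀ ξ : ℝ × ℝ × ℝ, dk1 p (-(2 * (k : ℤ))) ξ.1 ≠ 0 → dk1 p (k : ℤ) ξ.2.1 ≠ 0 →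
      dk1 p (k : ℤ) ξ.2.2 ≠ 0 →
      m * P ^ 2 ≤ (1 + dot3 ξ ξ) ^ s ∧ (1 + dot3 ξ ξ) ^ s ≤ M * P ^ 2) :
    √(m * (∫ u, dk1 p 0 u ^ 2) ^ 3) * P ≤ HsNormPhik p s k ∧
      HsNormPhik p s k ≤ √(M * (∫ u, dk1 p 0 u ^ 2) ^ 3) * P := by
  set g : ℝ × ℝ × ℝ → ℝ := fun ξ =>
    dk1 p (-(2 * (k : ℤ))) ξ.1 * dk1 p (k : ℤ) ξ.2.1 * dk1 p (k : ℤ) ξ.2.2 with hg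
  have hc : ∀ j, Continuous (dk1 p j) := fun j => (contDiff_dk1 hp_smooth j).continuous
  have hi : ∀ j, Integrable fun u => dk1 p j u ^ 2 := fun j =>
    ((hc j).pow 2).integrable_of_hasCompactSupport (hasCompactSupport_dk1_sq hp_one hp_zero j)
  have hgi : Integrable fun ξ => g ξ ^ 2 := by
    simp only [hg, mul_pow]
    exact integrable_tensor (hi _) (hi _) (hi _)
  have hgI : ∫ ξ, g ξ ^ 2 = (∫ u, dk1 p 0 u ^ 2) ^ 3 := by
    rw [← integral_comp_dk1_triple p (fun u => u ^ 2) k, ← integral_tensor]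
    simp only [hg, mul_pow]
  have hbd : ∀ ξ, m * P ^ 2 * g ξ ^ 2 ≤ (1 + dot3 ξ ξ) ^ s * g ξ ^ 2 ∧
      (1 + dot3 ξ ξ) ^ s * g ξ ^ 2 ≤ M * P ^ 2 * g ξ ^ 2 := by
    intro ξ
    by_cases h : g ξ = 0
    · simp [h]
    · simp only [hg, mul_ne_zero_iff, ← ne_eq] at h
      obtain ⟨l, u⟩ := hw ξ h.1.1 h.1.2 h.2
      exact ⟨mul_le_mul_of_nonneg_right l (sq_nonneg _),
        mul_le_mul_of_nonneg_right u (sq_nonneg _)⟩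
  have hdot : ∀ ξ, 0 ≤ dot3 ξ ξ := fun ξ => by
    unfold dot3; nlinarith [mul_self_nonneg ξ.1, mul_self_nonneg ξ.2.1, mul_self_nonneg ξ.2.2]
  have hnn : ∀ ξ, 0 ≤ (1 + dot3 ξ ξ) ^ s * g ξ ^ 2 := fun ξ => by
    have := hdot ξ
    positivity
  have hwi : Integrable fun ξ => (1 + dot3 ξ ξ) ^ s * g ξ ^ 2 := by
    refine (hgi.const_mul (M * P ^ 2)).mono' (Measurable.aestronglyMeasurable ?_)
      (Eventually.of_forall fun ξ => ?_)
    · have hd : Measurable fun ξ : ℝ × ℝ × ℝ => dot3 ξ ξ :=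
        (continuous_dot3.comp (continuous_id.prodMk continuous_id)).measurable
      have hgm : Measurable g := by
        have h₁ := (hc (-(2 * (k : ℤ)))).measurable
        have h₂ := (hc (k : ℤ)).measurable
        fun_prop
      exact ((measurable_const.add hd).pow_const s).mul (hgm.pow_const 2)
    · rw [Real.norm_eq_abs, abs_of_nonneg (hnn ξ)]
      exact (hbd ξ).2
  have hsqrt : ∀ c : ℝ, √(c * (∫ u, dk1 p 0 u ^ 2) ^ 3) * P = √(∫ ξ, c * P ^ 2 * g ξ ^ 2) := by
    intro c
    rw [integral_const_mul, hgI, mul_right_comm, Real.sqrt_mul' _ (sq_nonneg P), Real.sqrt_sq hP]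
  rw [hsqrt, hsqrt, HsNormPhik]
  exact ⟨Real.sqrt_le_sqrt (integral_mono (hgi.const_mul _) hwi fun ξ => (hbd ξ).1),
    Real.sqrt_le_sqrt (integral_mono hwi (hgi.const_mul _) fun ξ => (hbd ξ).2)⟩

/-- The `H^s` norm of `φ_k` is comparable to `2 ^ (k s)`. -/
lemma HsNormPhik_bounds (hp_smooth : ContDiff ℝ (⊤ : ℕ∞) p)
    (hp_one : ∀ ξ : ℝ, |ξ| ≤ 1 → p ξ = 1) (hp_zero : ∀ ξ : ℝ, 2 ≤ |ξ| → p ξ = 0)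
    (s : ℝ) (k : ℕ) :
    √(min 1 ((49 : ℝ) ^ s) * (∫ u, dk1 p 0 u ^ 2) ^ 3) * (2 : ℝ) ^ ((k : ℝ) * s)
        ≤ HsNormPhik p s k ∧
      HsNormPhik p s k ≤
        √(max 1 ((49 : ℝ) ^ s) * (∫ u, dk1 p 0 u ^ 2) ^ 3) * (2 : ℝ) ^ ((k : ℝ) * s) :=
  HsNormPhik_bounds_of_weight hp_smooth hp_one hp_zero (by positivity)
    fun _ => sobolev_weight_bounds hp_one hp_zero s

/-- Lower bound for the evolution at small times in the slab `|x| ≲ 2 ^ (2k)`, `y = z = 0`. -/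
lemma le_norm_Uphik (hp_smooth : ContDiff ℝ (⊤ : ℕ∞) p)
    (hp_one : ∀ ξ : ℝ, |ξ| ≤ 1 → p ξ = 1) (hp_zero : ∀ ξ : ℝ, 2 ≤ |ξ| → p ξ = 0)
    {k : ℕ} {x ε τ : ℝ} (hx : |x| ≤ ε * ((2 : ℝ) ^ k) ^ 2) (hτ : 0 ≤ τ) :
    (∫ u, dk1 p 0 u) ^ 3 - (4 * ε + 192 * τ) * (∫ u, |dk1 p 0 u|) ^ 3 ≤
      ‖Uphik p k τ (x, 0, 0)‖ := by
  have hc : ∀ j, Continuous (dk1 p j) := fun j => (contDiff_dk1 hp_smooth j).continuous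
  have hs : ∀ j, HasCompactSupport (dk1 p j) := hasCompactSupport_dk1 hp_one hp_zero
  have hN : (1 : ℝ) ≤ ((2 : ℝ) ^ k) ^ 2 := one_le_pow₀ (one_le_pow₀ one_le_two)
  have key := norm_oscI_sub_le (hc (-(2 * (k : ℤ)))) (hs _) (hc k) (hs _) (hc k) (hs _)
    (t := τ) (ε := 4 * ε + 192 * τ) (x := (x, 0, 0)) ?_
  · rw [integral_comp_dk1_triple p (fun u => |u|) k,
      integral_comp_dk1_triple p (fun u => u) k] at key
    have h1 := norm_sub_norm_le ((((∫ u, dk1 p 0 u) ^ 3 : ℝ) : ℂ)) (Uphik p k τ (x, 0, 0))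
    rw [norm_sub_rev, Complex.norm_real] at h1
    have h2 := Real.le_norm_self ((∫ u, dk1 p 0 u) ^ 3)
    have h3 : ‖Uphik p k τ (x, 0, 0) - (((∫ u, dk1 p 0 u) ^ 3 : ℝ) : ℂ)‖ ≤
      (4 * ε + 192 * τ) * (∫ u, |dk1 p 0 u|) ^ 3 := key
    linarith
  · intro ξ h₁ h₂ h₃
    obtain ⟨b₁, -, b₂, b₃⟩ := freq_bounds hp_one hp_zero h₁ h₂ h₃
    set K : ℝ := ((2 : ℝ) ^ k) ^ 2
    have e : dot3 (x, 0, 0) ξ + τ * omega3 ξ =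
        x * ξ.1 + τ * (ξ.1 * (ξ.1 ^ 2 + ξ.2.1 ^ 2 + ξ.2.2 ^ 2)) := by
      simp [dot3, omega3]
    have hξ : |ξ.1| ≤ 4 := by nlinarith [abs_nonneg ξ.1]
    have hξ2 : ξ.1 ^ 2 ≤ 16 := by nlinarith [sq_abs ξ.1, abs_nonneg ξ.1]
    have hsum : ξ.1 ^ 2 + ξ.2.1 ^ 2 + ξ.2.2 ^ 2 ≤ 48 * K := by nlinarith
    have hε : 0 ≤ ε := by
      by_contra! h
      nlinarith [abs_nonneg x]
    rw [e]
    refine (abs_add_le _ _).trans ?_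
    rw [abs_mul, abs_mul τ, abs_mul ξ.1, abs_of_nonneg hτ,
      abs_of_nonneg (by positivity : 0 ≤ ξ.1 ^ 2 + ξ.2.1 ^ 2 + ξ.2.2 ^ 2)]
    have i₁ : |x| * |ξ.1| ≤ 4 * ε := calc
      |x| * |ξ.1| ≤ ε * K * |ξ.1| := by gcongr
      _ = ε * (|ξ.1| * K) := by ring
      _ ≤ ε * 4 := by gcongr
      _ = 4 * ε := mul_comm _ _
    have i₂ : τ * (|ξ.1| * (ξ.1 ^ 2 + ξ.2.1 ^ 2 + ξ.2.2 ^ 2)) ≤ 192 * τ := calc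
      _ ≤ τ * (|ξ.1| * (48 * K)) := by gcongr
      _ = 48 * τ * (|ξ.1| * K) := by ring
      _ ≤ 48 * τ * 4 := by gcongr
      _ = 192 * τ := by ring
    linarith

end Family

/-! ### The maximal function -/

/-- The maximal function `x ↦ sup_{y, z, t ∈ [0, T]} t ^ α |u t (x, y, z)|`. -/
def maximalFn (u : ℝ → ℝ × ℝ × ℝ → ℂ) (α T x : ℝ) : ℝ :=
  ⨆ (y : ℝ) (z : ℝ) (t : Set.Icc (0 : ℝ) T), (t : ℝ) ^ α * ‖u (t : ℝ) (x, y, z)‖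

section Maximal

variable {u : ℝ → ℝ × ℝ × ℝ → ℂ} {α T M : ℝ}

lemma rpow_mul_norm_le (hα : 0 ≤ α) (hT1 : T ≤ 1) {x B : ℝ}
    (hB : ∀ t ∈ Set.Icc 0 T, ∀ y z, ‖u t (x, y, z)‖ ≤ B) (y z : ℝ) (t : Set.Icc (0 : ℝ) T) :
    (t : ℝ) ^ α * ‖u t (x, y, z)‖ ≤ B := by
  have h : (t : ℝ) ^ α ≤ 1 := Real.rpow_le_one t.2.1 (t.2.2.trans hT1) hα
  calc _ ≤ 1 * ‖u t (x, y, z)‖ := by gcongr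
    _ ≤ B := by rw [one_mul]; exact hB t t.2 y z

lemma maximalFn_le (hα : 0 ≤ α) (hT : 0 ≤ T) (hT1 : T ≤ 1) {x B : ℝ}
    (hB : ∀ t ∈ Set.Icc 0 T, ∀ y z, ‖u t (x, y, z)‖ ≤ B) : maximalFn u α T x ≤ B :=
  have : Nonempty (Set.Icc 0 T) := ⟨⟨0, le_rfl, hT⟩⟩
  ciSup_le fun y => ciSup_le fun z => ciSup_le fun t => rpow_mul_norm_le hα hT1 hB y z t

lemma bddAbove_maximalFn (hα : 0 ≤ α) (hT : 0 ≤ T) (hT1 : T ≤ 1)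
    (hM : ∀ t ∈ Set.Icc 0 T, ∀ x, ‖u t x‖ ≤ M) (x : ℝ) :
    (BddAbove (Set.range fun y : ℝ => ⨆ (z : ℝ) (t : Set.Icc (0 : ℝ) T),
        (t : ℝ) ^ α * ‖u (t : ℝ) (x, y, z)‖)) ∧
    (∀ y, BddAbove (Set.range fun z : ℝ => ⨆ t : Set.Icc (0 : ℝ) T,
        (t : ℝ) ^ α * ‖u (t : ℝ) (x, y, z)‖)) ∧
    ∀ y z, BddAbove (Set.range fun t : Set.Icc (0 : ℝ) T =>
        (t : ℝ) ^ α * ‖u (t : ℝ) (x, y, z)‖) := by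
  have : Nonempty (Set.Icc 0 T) := ⟨⟨0, le_rfl, hT⟩⟩
  have h := rpow_mul_norm_le (x := x) hα hT1 fun t ht y z => hM t ht (x, y, z)
  refine ⟨⟨M, ?_⟩, fun y => ⟨M, ?_⟩, fun y z => ⟨M, ?_⟩⟩
  · rintro _ ⟨y, rfl⟩
    exact ciSup_le fun z => ciSup_le fun t => h y z t
  · rintro _ ⟨z, rfl⟩
    exact ciSup_le fun t => h y z t
  · rintro _ ⟨t, rfl⟩
    exact h y z t

lemma le_maximalFn (hα : 0 ≤ α) (hT : 0 ≤ T) (hT1 : T ≤ 1)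
    (hM : ∀ t ∈ Set.Icc 0 T, ∀ x, ‖u t x‖ ≤ M) (x y z : ℝ) (t : Set.Icc (0 : ℝ) T) :
    (t : ℝ) ^ α * ‖u t (x, y, z)‖ ≤ maximalFn u α T x := by
  obtain ⟨b₁, b₂, b₃⟩ := bddAbove_maximalFn (α := α) hα hT hT1 hM x
  exact (le_ciSup (b₃ y z) t).trans ((le_ciSup (b₂ y) z).trans (le_ciSup b₁ y))

lemma measurable_maximalFn (hα : 0 ≤ α) (hT : 0 ≤ T) (hT1 : T ≤ 1)
    (hM : ∀ t ∈ Set.Icc 0 T, ∀ x, ‖u t x‖ ≤ M) (hu : ∀ t, Continuous (u t)) :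
    Measurable (maximalFn u α T) := by
  have hb := bddAbove_maximalFn (α := α) hα hT hT1 hM
  refine LowerSemicontinuous.measurable ?_
  unfold maximalFn
  refine lowerSemicontinuous_ciSup (fun x => (hb x).1) fun y =>
    lowerSemicontinuous_ciSup (fun x => (hb x).2.1 y) fun z =>
    lowerSemicontinuous_ciSup (fun x => (hb x).2.2 y z) fun t => Continuous.lowerSemicontinuous ?_
  have := hu t
  fun_prop

/-- If `u` is bounded and `O(1 / |x|)`, uniformly in `y`, `z` and `t`, then its maximal function is
square integrable. -/
lemma integrable_maximalFn_sq (hα : 0 ≤ α) (hT : 0 ≤ T) (hT1 : T ≤ 1)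
    (hM : ∀ t ∈ Set.Icc 0 T, ∀ x, ‖u t x‖ ≤ M) (hu : ∀ t, Continuous (u t)) {C : ℝ}
    (hC : ∀ t ∈ Set.Icc 0 T, ∀ x y z, |x| * ‖u t (x, y, z)‖ ≤ C) :
    Integrable fun x => maximalFn u α T x ^ 2 := by
  refine (integrable_inv_one_add_sq.const_mul (M ^ 2 + C ^ 2)).mono'
    ((measurable_maximalFn hα hT hT1 hM hu).pow_const 2).aestronglyMeasurable
    (Eventually.of_forall fun x => ?_)
  have h0 : 0 ≤ maximalFn u α T x := by
    refine le_trans ?_ (le_maximalFn hα hT hT1 hM x 0 0 ⟨0, le_rfl, hT⟩)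
    positivity
  have hM' : maximalFn u α T x ≤ M := maximalFn_le hα hT hT1 fun t ht y z => hM t ht _
  have hC' : |x| * maximalFn u α T x ≤ C := by
    rcases eq_or_ne x 0 with rfl | hx
    · have := hC 0 ⟨le_rfl, hT⟩ 0 0 0
      simpa using this
    · rw [← le_div_iff₀' (abs_pos.2 hx)]
      exact maximalFn_le hα hT hT1 fun t ht y z =>
        (le_div_iff₀' (abs_pos.2 hx)).2 (hC t ht x y z)
  rw [Real.norm_eq_abs, abs_of_nonneg (sq_nonneg _), ← div_eq_mul_inv,
    le_div_iff₀ (by positivity)]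
  have h1 : maximalFn u α T x ^ 2 ≤ M ^ 2 := by gcongr
  have h2 : (|x| * maximalFn u α T x) ^ 2 ≤ C ^ 2 := by gcongr
  rw [mul_pow, sq_abs] at h2
  linarith

end Maximal

lemma integrable_maximalFn_Uphik_sq {p : ℝ → ℝ} (hp_smooth : ContDiff ℝ (⊤ : ℕ∞) p)
    (hp_one : ∀ ξ : ℝ, |ξ| ≤ 1 → p ξ = 1) (hp_zero : ∀ ξ : ℝ, 2 ≤ |ξ| → p ξ = 0) (k : ℕ)
    {α T : ℝ} (hα : 0 ≤ α) (hT : 0 ≤ T) (hT1 : T ≤ 1) :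
    Integrable fun x => maximalFn (Uphik p k) α T x ^ 2 := by
  have hd : ∀ j, ContDiff ℝ 1 (dk1 p j) := contDiff_dk1 hp_smooth
  have hs : ∀ j, HasCompactSupport (dk1 p j) := hasCompactSupport_dk1 hp_one hp_zero
  obtain ⟨C, hC⟩ := exists_abs_mul_norm_oscI_le (hd (-(2 * (k : ℤ)))) (hs _)
    (hd k).continuous (hs _) (hd k).continuous (hs _)
  refine integrable_maximalFn_sq hα hT hT1 (fun t _ x => norm_oscI_le _ _ _ t x)
    (fun t => continuous_oscI (hd _).continuous (hs _) (hd _).continuous (hs _)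
      (hd _).continuous (hs _) t) (C := C) fun t ht x y z => hC t x y z ?_
  rw [abs_of_nonneg ht.1]
  exact ht.2.trans hT1

lemma mul_sqrt_le_sqrt_integral_sq {f : ℝ → ℝ} (hf : Integrable fun x => f x ^ 2) {b r : ℝ}
    (hb : 0 ≤ b) (hr : 0 ≤ r) (h : ∀ x, |x| ≤ r → b ≤ f x) :
    b * √(2 * r) ≤ √(∫ x, f x ^ 2) := by
  refine Real.le_sqrt_of_sq_le ?_
  rw [mul_pow, Real.sq_sqrt (by positivity)]
  calc b ^ 2 * (2 * r) = ∫ _ in Set.Icc (-r) r, b ^ 2 := by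
        rw [setIntegral_const, Measure.real, Real.volume_Icc, ENNReal.toReal_ofReal (by linarith),
          smul_eq_mul]
        ring
    _ ≤ ∫ x in Set.Icc (-r) r, f x ^ 2 := by
        refine setIntegral_mono_on ?_ hf.integrableOn measurableSet_Icc fun x hx => ?_
        · simp
        · have := h x (abs_le.2 hx)
          gcongr
    _ ≤ ∫ x, f x ^ 2 := setIntegral_le_integral hf (Eventually.of_forall fun x => sq_nonneg _)

/-- Key step of the sharpness proof: (i) ‖φ_k‖_{H^s} ∼ 2^{ks}, and
(ii) ‖t^α U(t)φ_k‖_{L²_x L^∞_{yzT}} ≳ 2^k for large k. -/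
theorem phik_bounds
    (p : ℝ → ℝ) (hp_smooth : ContDiff ℝ (⊤ : ℕ∞) p) (hp_nonneg : ∀ ξ, 0 ≤ p ξ)
    (hp_one : ∀ ξ : ℝ, |ξ| ≤ 1 → p ξ = 1) (hp_zero : ∀ ξ : ℝ, 2 ≤ |ξ| → p ξ = 0) :
    (∀ s : ℝ, ∃ c₁ c₂ : ℝ, 0 < c₁ ∧ 0 < c₂ ∧ ∀ k : ℕ, 1 ≤ k →
      c₁ * (2:ℝ) ^ ((k : ℝ) * s) ≤ HsNormPhik p s k ∧
      HsNormPhik p s k ≤ c₂ * (2:ℝ) ^ ((k : ℝ) * s)) ∧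
    (∀ α : ℝ, 0 ≤ α → ∀ T : ℝ, 0 < T → T < 1 → ∃ c : ℝ, 0 < c ∧ ∃ k₀ : ℕ, ∀ k : ℕ, k₀ ≤ k →
      c * 2 ^ k ≤ Real.sqrt (∫ x : ℝ, (⨆ (y : ℝ) (z : ℝ) (t : Set.Icc (0:ℝ) T),
          (t : ℝ) ^ α * ‖Uphik p k (t : ℝ) (x, y, z)‖) ^ 2)) := by
  refine ⟨fun s => ?_, fun α hα T hT hT1 => ?_⟩
  · have hA := integral_dk1_zero_sq_pos hp_smooth hp_nonneg hp_one hp_zero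
    exact ⟨_, _, by positivity, by positivity,
      fun k _ => HsNormPhik_bounds hp_smooth hp_one hp_zero s k⟩
  · have hI := integral_dk1_zero_pos hp_smooth hp_nonneg hp_one hp_zero
    have hJ := integral_abs_dk1_zero_pos hp_smooth hp_nonneg hp_one hp_zero
    set I : ℝ := (∫ u, dk1 p 0 u) ^ 3 with hIdef
    set J : ℝ := (∫ u, |dk1 p 0 u|) ^ 3 with hJdef
    have hI3 : 0 < I := by positivity
    have hJ3 : 0 < J := by positivity
    set ε : ℝ := I / (16 * J) with hε
    set τ : ℝ := min T (I / (768 * J)) with hτ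
    have hε0 : 0 < ε := by positivity
    have hτ0 : 0 < τ := by positivity
    have hεJ : ε * J = I / 16 := by rw [hε]; field_simp
    have hτJ : τ * J ≤ I / 768 := by
      calc τ * J ≤ I / (768 * J) * J := by gcongr; exact min_le_right _ _
        _ = I / 768 := by field_simp
    refine ⟨τ ^ α * (I / 2) * √(2 * ε), by positivity, 0, fun k _ => ?_⟩
    have hN : (0 : ℝ) < 2 ^ k := by positivity
    have hlow : ∀ x, |x| ≤ ε * ((2 : ℝ) ^ k) ^ 2 →
        τ ^ α * (I / 2) ≤ maximalFn (Uphik p k) α T x := by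
      intro x hx
      refine le_trans ?_ (le_maximalFn hα hT.le hT1.le (fun t _ x => norm_oscI_le _ _ _ t x)
        x 0 0 ⟨τ, hτ0.le, min_le_left _ _⟩)
      have h := le_norm_Uphik hp_smooth hp_one hp_zero hx hτ0.le
      gcongr
      refine le_trans ?_ h
      rw [← hIdef, ← hJdef]
      linarith
    have hmain := mul_sqrt_le_sqrt_integral_sq
      (integrable_maximalFn_Uphik_sq hp_smooth hp_one hp_zero k hα hT.le hT1.le)
      (by positivity) (by positivity) hlow
    rw [← mul_assoc 2, Real.sqrt_mul (by positivity), Real.sqrt_sq hN.le, ← mul_assoc] at hmain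
    exact hmain
end
end

section
/- Retarded estimate for the gradient of the Duhamel term (estimate (est-nhgroup)): there exists C>0 such that for every T>0 and every Schwartz function f on ℝ×ℝ³, sup_{t∈[0,T]} ‖ ∇ ∫₀^t U(t−t') f(t',·) dt' ‖_{L²(ℝ³)} ≤ C ∫_ℝ ( ∫₀^T ∫_{ℝ²} |f(t,x,y,z)|² dy dz dt )^{1/2} dx, where ∇ is the spatial gradient. -/
open MeasureTheory Real Filter
open scoped ENNReal

noncomputable section

/-- Duhamel term with a Fourier multiplier m applied:
∫₀^t (m(D) U(t-t') f(t',·))(x̄) dt', computed on the frequency side. -/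
def duhamel (m : ℝ × ℝ × ℝ → ℂ) (f : ℝ × (ℝ × ℝ × ℝ) → ℂ) (t : ℝ) (x : ℝ × ℝ × ℝ) : ℂ :=
  ∫ s in (0:ℝ)..t, ∫ ξ : ℝ × ℝ × ℝ,
    Complex.exp (Complex.I * ((dot3 x ξ + (t - s) * omega3 ξ : ℝ) : ℂ)) * m ξ *
      FT3 (fun w => f (s, w)) ξ

open scoped FourierTransform SchwartzMap

theorem lintegral_enorm_fourier_sq_le (h : ℝ → ℂ) (hi : Integrable h) :
    ∫⁻ x, ‖𝓕 h x‖ₑ ^ 2 ≤ ∫⁻ x, ‖h x‖ₑ ^ 2 := by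
  by_cases htop : ∫⁻ x, ‖h x‖ₑ ^ 2 = ∞
  · simp [htop]
  have key (g : ℝ → ℂ) : eLpNorm g 2 volume ^ 2 = ∫⁻ x, ‖g x‖ₑ ^ 2 := by
    rw [eLpNorm_eq_lintegral_rpow_enorm_toReal (by norm_num) (by norm_num), ← ENNReal.rpow_natCast,
      ← ENNReal.rpow_mul]
    norm_num
  have hm : MemLp h 2 := by
    refine ⟨hi.aestronglyMeasurable, ?_⟩
    by_contra hc
    rw [not_lt, top_le_iff] at hc
    apply htop
    rw [← key, hc]
    simp
  have hcont : Continuous (𝓕 h) :=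
    VectorFourier.fourierIntegral_continuous Real.continuous_fourierChar
      (by exact continuous_inner) hi
  set u : Lp ℂ 2 (volume : Measure ℝ) := hm.toLp h with hu
  have hae : ∀ᵐ x, (𝓕 u : Lp ℂ 2 (volume : Measure ℝ)) x = 𝓕 h x := by
    apply ae_eq_of_integral_contDiff_smul_eq
    · exact (Lp.memLp (𝓕 u)).locallyIntegrable (by norm_num)
    · exact hcont.locallyIntegrable
    intro g hg hgs
    let φ : 𝓢(ℝ, ℂ) := HasCompactSupport.toSchwartzMap (f := fun x => (g x : ℂ))
      (hgs.comp_left (g := fun x : ℝ => (x : ℂ)) (by simp)) (Complex.ofRealCLM.contDiff.comp hg)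
    have h1 := congrArg (fun d => d φ) (Lp.fourier_toTemperedDistribution_eq u)
    simp only [TemperedDistribution.fourier_apply, Lp.toTemperedDistribution_apply] at h1
    have h2 : ∫ x, (𝓕 φ) x • u x = ∫ x, (𝓕 φ) x • h x := by
      apply integral_congr_ae
      filter_upwards [hm.coeFn_toLp] with x hx
      rw [hu, hx]
    have h3 : ∫ x, (𝓕 φ) x • h x = ∫ x, φ x • 𝓕 h x := by
      rw [SchwartzMap.fourier_coe]
      have := VectorFourier.integral_fourierIntegral_smul_eq_flip (μ := volume) (ν := volume)
        (L := innerₗ ℝ) (f := (φ : ℝ → ℂ)) (g := h)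
        Real.continuous_fourierChar (by exact continuous_inner) φ.integrable hi
      rw [flip_innerₗ] at this
      exact this
    have h4 (x : ℝ) (c : ℂ) : φ x • c = g x • c := by
      change (g x : ℂ) • c = g x • c
      simp
    rw [h2, h3] at h1
    simp only [h4] at h1
    exact h1.symm
  have h5 : eLpNorm (𝓕 h) 2 volume = eLpNorm h 2 volume := by
    rw [← eLpNorm_congr_ae hae, ← eLpNorm_congr_ae hm.coeFn_toLp]
    have := Lp.norm_fourier_eq u
    rw [Lp.norm_def, Lp.norm_def, ENNReal.toReal_eq_toReal_iff' (Lp.eLpNorm_ne_top _)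
      (Lp.eLpNorm_ne_top _)] at this
    exact this
  rw [← key, ← key, h5]

/-- A measurable kernel of modulus at most one whose integral operator is bounded on `L²`,
with squared operator norm at most `A`. -/
structure IsL2Kernel {X Y : Type*} [MeasureSpace X] [MeasureSpace Y] (K : X → Y → ℂ) (A : ℝ≥0∞) :
    Prop where
  measurable : Measurable (Function.uncurry K)
  norm_le : ∀ x y, ‖K x y‖ ≤ 1
  bound : ∀ h : Y → ℂ, Measurable h → Integrable h →
    ∫⁻ x, ‖∫ y, K x y * h y‖ₑ ^ 2 ≤ A * ∫⁻ y, ‖h y‖ₑ ^ 2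

theorem isL2Kernel_exp {σ : ℝ} (hσ : |σ| = 1) :
    IsL2Kernel (fun x y : ℝ => Complex.exp (Complex.I * ((σ * (x * y) : ℝ) : ℂ)))
      (ENNReal.ofReal (2 * π)) where
  measurable := by unfold Function.uncurry; fun_prop
  norm_le x y := by rw [mul_comm, Complex.norm_exp_ofReal_mul_I]
  bound h hm hi := by
    have hσ0 : σ ≠ 0 := by rintro rfl; simp at hσ
    set a : ℝ := -σ / (2 * π)
    have ha : a ≠ 0 := by
      simp only [a]; exact div_ne_zero (by simpa using hσ0) (by positivity)
    have h1 (x : ℝ) : ∫ y, Complex.exp (Complex.I * ((σ * (x * y) : ℝ) : ℂ)) * h y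
        = 𝓕 h (a * x) := by
      rw [Real.fourier_real_eq_integral_exp_smul]
      congr 1; ext y
      rw [smul_eq_mul]
      congr 2
      rw [mul_comm]
      congr 2
      simp only [a]
      field_simp
    simp only [h1]
    have h2 : ∫⁻ x, ‖𝓕 h (a * x)‖ₑ ^ 2 = ENNReal.ofReal (2 * π) * ∫⁻ x, ‖𝓕 h x‖ₑ ^ 2 := by
      have := lintegral_map_equiv (fun x => ‖𝓕 h x‖ₑ ^ 2)
        (Homeomorph.mulLeft₀ a ha).toMeasurableEquiv (μ := volume)
      simp only [Homeomorph.toMeasurableEquiv_coe, Homeomorph.coe_mulLeft₀] at this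
      rw [← this, Real.map_volume_mul_left ha, lintegral_smul_measure]
      congr 2
      simp only [a]
      rw [abs_inv, abs_div, abs_neg, hσ, abs_of_pos (by positivity)]
      simp
    rw [h2]
    exact mul_le_mul' le_rfl (lintegral_enorm_fourier_sq_le h hi)

theorem IsL2Kernel.prod {X Y X' Y' : Type*} [MeasureSpace X] [MeasureSpace Y]
    [MeasureSpace X'] [MeasureSpace Y'] [SFinite (volume : Measure X)]
    [SFinite (volume : Measure X')] [SFinite (volume : Measure Y)] [SFinite (volume : Measure Y')]
    {K : X → Y → ℂ} {K' : X' → Y' → ℂ} {A A' : ℝ≥0∞}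
    (hK : IsL2Kernel K A) (hK' : IsL2Kernel K' A') :
    IsL2Kernel (fun (x : X × X') (y : Y × Y') => K x.1 y.1 * K' x.2 y.2) (A * A') where
  measurable := by
    have h1 := hK.measurable
    have h2 := hK'.measurable
    have e1 : Measurable fun p : (X × X') × (Y × Y') => Function.uncurry K (p.1.1, p.2.1) := by
      fun_prop
    have e2 : Measurable fun p : (X × X') × (Y × Y') => Function.uncurry K' (p.1.2, p.2.2) := by
      fun_prop
    exact e1.mul e2
  norm_le x y := by
    rw [norm_mul]
    exact mul_le_one₀ (hK.norm_le _ _) (norm_nonneg _) (hK'.norm_le _ _)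
  bound h hm hi := by
    have m1 : Measurable fun q : (X × X') × (Y × Y') => K q.1.1 q.2.1 :=
      hK.measurable.comp (f := fun q : (X × X') × (Y × Y') => (q.1.1, q.2.1)) (by fun_prop)
    have m2 : Measurable fun q : (X' × Y) × Y' => K' q.1.1 q.2 :=
      hK'.measurable.comp (f := fun q : (X' × Y) × Y' => (q.1.1, q.2)) (by fun_prop)
    have m3 (x : X) : Measurable fun y => K x y := hK.measurable.of_uncurry_left
    have m4 (x : X') : Measurable fun y => K' x y := hK'.measurable.of_uncurry_left
    have m5 : Measurable fun q : (X' × X) × Y => K q.1.2 q.2 :=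
      hK.measurable.comp (f := fun q : (X' × X) × Y => (q.1.2, q.2)) (by fun_prop)
    set k : X' × Y → ℂ := fun q => ∫ y', K' q.1 y' * h (q.2, y') with hk
    have hkm : Measurable k := by
      apply StronglyMeasurable.measurable
      apply StronglyMeasurable.integral_prod_right (f := fun (q : X' × Y) y' => K' q.1 y' * h (q.2, y'))
      apply Measurable.stronglyMeasurable
      exact m2.mul (hm.comp (f := fun q : (X' × Y) × Y' => (q.1.2, q.2)) (by fun_prop))
    have hint' (x' : X') : Integrable fun p : Y × Y' => K' x' p.2 * h p := by
      refine hi.bdd_mul (c := 1) ((m4 x').comp measurable_snd).aestronglyMeasurable ?_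
      exact .of_forall fun p => hK'.norm_le _ _
    have hki (x' : X') : Integrable fun y => k (x', y) := (hint' x').integral_prod_left
    have hF (x : X) (x' : X') : ∫ p : Y × Y', K x p.1 * K' x' p.2 * h p
        = ∫ y, K x y * k (x', y) := by
      simp only [mul_assoc]
      rw [Measure.volume_eq_prod, integral_prod]
      · simp only [hk, integral_const_mul]
      · refine (hint' x').bdd_mul (c := 1) ((m3 x).comp measurable_fst).aestronglyMeasurable ?_
        exact .of_forall fun p => hK.norm_le _ _
    calc ∫⁻ x : X × X', ‖∫ p : Y × Y', K x.1 p.1 * K' x.2 p.2 * h p‖ₑ ^ 2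
        = ∫⁻ x : X × X', ‖∫ y, K x.1 y * k (x.2, y)‖ₑ ^ 2 := by simp only [hF]
      _ = ∫⁻ x', ∫⁻ x, ‖∫ y, K x y * k (x', y)‖ₑ ^ 2 := by
          rw [Measure.volume_eq_prod, lintegral_prod_symm']
          have : StronglyMeasurable fun q : X × X' => ∫ y, K q.1 y * k (q.2, y) := by
            apply StronglyMeasurable.integral_prod_right
              (f := fun (q : X × X') y => K q.1 y * k (q.2, y))
            apply Measurable.stronglyMeasurable
            exact (hK.measurable.comp (f := fun q : (X × X') × Y => (q.1.1, q.2)) (by fun_prop)).mul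
              (hkm.comp (f := fun q : (X × X') × Y => (q.1.2, q.2)) (by fun_prop))
          exact this.measurable.enorm.pow_const 2
      _ ≤ ∫⁻ x', A * ∫⁻ y, ‖k (x', y)‖ₑ ^ 2 :=
          lintegral_mono fun x' => hK.bound _ (hkm.comp measurable_prodMk_left) (hki x')
      _ = A * ∫⁻ y, ∫⁻ x', ‖k (x', y)‖ₑ ^ 2 := by
          rw [lintegral_const_mul, lintegral_lintegral_swap]
          · exact (hkm.enorm.pow_const 2).aemeasurable
          · exact (hkm.enorm.pow_const 2).lintegral_prod_right'
      _ ≤ A * ∫⁻ y, A' * ∫⁻ y', ‖h (y, y')‖ₑ ^ 2 := by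
          refine mul_le_mul' le_rfl (lintegral_mono_ae ?_)
          filter_upwards [hi.prod_right_ae] with y hy
          exact hK'.bound _ (hm.comp measurable_prodMk_left) hy
      _ = A * A' * ∫⁻ y, ‖h y‖ₑ ^ 2 := by
          rw [lintegral_const_mul, mul_assoc, Measure.volume_eq_prod, lintegral_prod]
          · exact (hm.enorm.pow_const 2).aemeasurable
          · exact (hm.enorm.pow_const 2).lintegral_prod_right'

theorem lintegral_sq_lintegral_le {X Y : Type*} [MeasurableSpace X] [MeasurableSpace Y]
    {μ : Measure X} {ν : Measure Y} [SFinite μ] [SFinite ν] {F : X → Y → ℝ≥0∞}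
    (hF : Measurable (Function.uncurry F)) :
    ∫⁻ y, (∫⁻ x, F x y ∂μ) ^ 2 ∂ν ≤ (∫⁻ x, (∫⁻ y, F x y ^ 2 ∂ν) ^ (1 / 2 : ℝ) ∂μ) ^ 2 := by
  have m1 (y : Y) : Measurable fun x => F x y := hF.of_uncurry_right
  have m2 (x : X) : Measurable fun y => F x y := hF.of_uncurry_left
  have hN : Measurable fun x => (∫⁻ y, F x y ^ 2 ∂ν) ^ (1 / 2 : ℝ) :=
    (Measurable.lintegral_prod_right' (f := fun p : X × Y => F p.1 p.2 ^ 2)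
      (hF.pow_const 2)).pow_const _
  calc ∫⁻ y, (∫⁻ x, F x y ∂μ) ^ 2 ∂ν
      = ∫⁻ y, ∫⁻ x, ∫⁻ x', F x y * F x' y ∂μ ∂μ ∂ν := by
        congr 1; ext y
        simp_rw [lintegral_const_mul _ (m1 y)]
        rw [lintegral_mul_const _ (m1 y), sq]
    _ = ∫⁻ x, ∫⁻ y, ∫⁻ x', F x y * F x' y ∂μ ∂ν ∂μ := by
        rw [lintegral_lintegral_swap]
        apply Measurable.aemeasurable
        apply Measurable.lintegral_prod_right' (f := fun p : (Y × X) × X => F p.1.2 p.1.1 * F p.2 p.1.1)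
        exact (hF.comp (f := fun p : (Y × X) × X => (p.1.2, p.1.1)) (by fun_prop)).mul
          (hF.comp (f := fun p : (Y × X) × X => (p.2, p.1.1)) (by fun_prop))
    _ = ∫⁻ x, ∫⁻ x', ∫⁻ y, F x y * F x' y ∂ν ∂μ ∂μ := by
        congr 1; ext x
        rw [lintegral_lintegral_swap]
        apply Measurable.aemeasurable
        exact (hF.comp (f := fun p : Y × X => (x, p.1)) (by fun_prop)).mul
          (hF.comp (f := fun p : Y × X => (p.2, p.1)) (by fun_prop))
    _ ≤ ∫⁻ x, ∫⁻ x', (∫⁻ y, F x y ^ 2 ∂ν) ^ (1 / 2 : ℝ) * (∫⁻ y, F x' y ^ 2 ∂ν) ^ (1 / 2 : ℝ)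
          ∂μ ∂μ := by
        refine lintegral_mono fun x => lintegral_mono fun x' => ?_
        have := ENNReal.lintegral_mul_le_Lp_mul_Lq ν Real.HolderConjugate.two_two
          (m2 x).aemeasurable (m2 x').aemeasurable
        simpa using this
    _ = (∫⁻ x, (∫⁻ y, F x y ^ 2 ∂ν) ^ (1 / 2 : ℝ) ∂μ) ^ 2 := by
        simp_rw [lintegral_const_mul _ hN]
        rw [lintegral_mul_const _ hN, sq]

theorem lintegral_dot3_mul_comp_omega3_le (G : ℝ → ℝ≥0∞) (q : ℝ × ℝ) :
    ∫⁻ ξ : ℝ, ENNReal.ofReal (dot3 (ξ, q) (ξ, q)) * G (omega3 (ξ, q)) ≤ ∫⁻ τ, G τ := by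
  have hd (ξ : ℝ) : HasDerivAt (fun ξ => omega3 (ξ, q)) (3 * ξ ^ 2 + (q.1 ^ 2 + q.2 ^ 2)) ξ := by
    have h1 := (hasDerivAt_pow 3 ξ).fun_add ((hasDerivAt_id ξ).mul_const (q.1 ^ 2 + q.2 ^ 2))
    have h2 : (fun ξ => omega3 (ξ, q)) = fun ξ => ξ ^ 3 + id ξ * (q.1 ^ 2 + q.2 ^ 2) := by
      ext x; simp only [omega3, id]; ring
    rw [h2]
    simpa using h1
  have hinj : Function.Injective (fun ξ => omega3 (ξ, q)) := by
    apply StrictMono.injective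
    intro a b hab
    simp only [omega3]
    have : 0 < (b - a) * (a ^ 2 + a * b + b ^ 2) := by
      apply mul_pos (by linarith)
      have : 0 < (b - a) ^ 2 := by apply pow_pos; linarith
      nlinarith [sq_nonneg (a + b), sq_nonneg a, sq_nonneg b]
    nlinarith [sq_nonneg q.1, sq_nonneg q.2]
  calc ∫⁻ ξ : ℝ, ENNReal.ofReal (dot3 (ξ, q) (ξ, q)) * G (omega3 (ξ, q))
      ≤ ∫⁻ ξ : ℝ in Set.univ, ENNReal.ofReal |3 * ξ ^ 2 + (q.1 ^ 2 + q.2 ^ 2)| * G (omega3 (ξ, q)) := by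
        rw [Measure.restrict_univ]
        gcongr with ξ
        refine le_trans ?_ (le_abs_self _)
        simp only [dot3]
        nlinarith [sq_nonneg ξ]
    _ = ∫⁻ τ in (fun ξ => omega3 (ξ, q)) '' Set.univ, G τ :=
        (lintegral_image_eq_lintegral_abs_deriv_mul MeasurableSet.univ
          (fun x _ => (hd x).hasDerivWithinAt) hinj.injOn G).symm
    _ ≤ ∫⁻ τ, G τ := setLIntegral_le_lintegral _ _

/-- The integrable weight `(1 + r²)⁻¹` on `ℝ`. -/
def lorentz (r : ℝ) : ℝ := (1 + r ^ 2)⁻¹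

theorem lorentz_pos (r : ℝ) : 0 < lorentz r := by unfold lorentz; positivity

theorem lorentz_le_one (r : ℝ) : lorentz r ≤ 1 :=
  inv_le_one_of_one_le₀ (by nlinarith [sq_nonneg r])

theorem integrable_lorentz : Integrable lorentz := integrable_inv_one_add_sq

theorem integrable_lorentz3 :
    Integrable fun p : ℝ × ℝ × ℝ => lorentz p.1 * (lorentz p.2.1 * lorentz p.2.2) :=
  integrable_lorentz.mul_prod (integrable_lorentz.mul_prod integrable_lorentz)

theorem SchwartzMap.exists_norm_le_lorentz (f : 𝓢(ℝ × ℝ × ℝ × ℝ, ℂ)) :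
    ∃ C : ℝ, 0 ≤ C ∧ ∀ s x y z, ‖f (s, x, y, z)‖ ≤
      C * (lorentz s * lorentz x * lorentz y * lorentz z) := by
  refine ⟨2 ^ 8 * (Finset.Iic (8, 0)).sup (fun m => SchwartzMap.seminorm ℝ m.1 m.2) f,
    by positivity, fun s x y z => ?_⟩
  have h := one_add_le_sup_seminorm_apply (𝕜 := ℝ) (m := (8, 0)) (k := 8) (n := 0)
    le_rfl le_rfl f (s, x, y, z)
  rw [norm_iteratedFDeriv_zero] at h
  set N := ‖(s, x, y, z)‖
  have hN : 0 ≤ N := norm_nonneg _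
  have aux (r : ℝ) (hr : |r| ≤ N) : 1 + r ^ 2 ≤ (1 + N) ^ 2 := by
    have : r ^ 2 ≤ N ^ 2 := sq_le_sq' (by linarith [neg_abs_le r]) (by linarith [le_abs_self r])
    nlinarith
  have h1 : |s| ≤ N := by simp [N, Prod.norm_def]
  have h2 : |x| ≤ N := by simp [N, Prod.norm_def]
  have h3 : |y| ≤ N := by simp [N, Prod.norm_def]
  have h4 : |z| ≤ N := by simp [N, Prod.norm_def]
  simp only [lorentz]
  rw [← mul_inv, ← mul_inv, ← mul_inv, ← div_eq_mul_inv, le_div_iff₀ (by positivity), mul_comm]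
  refine le_trans ?_ h
  gcongr
  calc (1 + s ^ 2) * (1 + x ^ 2) * (1 + y ^ 2) * (1 + z ^ 2)
      ≤ (1 + N) ^ 2 * (1 + N) ^ 2 * (1 + N) ^ 2 * (1 + N) ^ 2 := by
        gcongr <;> exact aux _ ‹_›
    _ = (1 + N) ^ 8 := by ring

theorem SchwartzMap.exists_norm_slice_le_lorentz (f : 𝓢(ℝ × ℝ × ℝ × ℝ, ℂ)) :
    ∃ C : ℝ, 0 ≤ C ∧ ∀ s (w : ℝ × ℝ × ℝ), ‖f (s, w)‖ ≤
      C * (lorentz w.1 * (lorentz w.2.1 * lorentz w.2.2)) := by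
  obtain ⟨C, hC, h⟩ := f.exists_norm_le_lorentz
  refine ⟨C, hC, fun s ⟨x, y, z⟩ => (h s x y z).trans (mul_le_mul_of_nonneg_left ?_ hC)⟩
  have hx := lorentz_pos x
  have hy := lorentz_pos y
  have hz := lorentz_pos z
  rw [mul_assoc, mul_assoc]
  exact mul_le_of_le_one_left (by positivity) (lorentz_le_one s)

theorem SchwartzMap.integrable_slice (f : 𝓢(ℝ × ℝ × ℝ × ℝ, ℂ)) (s : ℝ) :
    Integrable fun w : ℝ × ℝ × ℝ => f (s, w) := by
  obtain ⟨C, hC, h⟩ := f.exists_norm_slice_le_lorentz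
  exact (integrable_lorentz3.const_mul C).mono'
    (f.continuous.comp (by fun_prop)).aestronglyMeasurable (.of_forall fun w => h s w)

theorem exists_norm_FT3_slice_le (f : 𝓢(ℝ × ℝ × ℝ × ℝ, ℂ)) :
    ∃ C : ℝ, 0 ≤ C ∧ ∀ s ξ, ‖FT3 (fun w => f (s, w)) ξ‖ ≤ C := by
  obtain ⟨C, hC, h⟩ := f.exists_norm_slice_le_lorentz
  refine ⟨((2 * π) ^ 3)⁻¹ * ∫ p : ℝ × ℝ × ℝ, C * (lorentz p.1 * (lorentz p.2.1 * lorentz p.2.2)),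
    ?_, fun s ξ => ?_⟩
  · refine mul_nonneg (by positivity) (integral_nonneg fun p => ?_)
    exact (norm_nonneg _).trans (h 0 p)
  · rw [FT3, norm_mul, Complex.norm_real, Real.norm_of_nonneg (by positivity)]
    gcongr
    refine norm_integral_le_of_norm_le (integrable_lorentz3.const_mul C)
      (.of_forall fun w => ?_)
    rw [norm_mul, neg_mul, ← mul_neg, ← Complex.ofReal_neg, mul_comm Complex.I,
      Complex.norm_exp_ofReal_mul_I, one_mul]
    exact h s w

theorem integrable_exp_mul_slice (f : 𝓢(ℝ × ℝ × ℝ × ℝ, ℂ)) (s : ℝ) (ξ : ℝ × ℝ × ℝ) :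
    Integrable fun w : ℝ × ℝ × ℝ => Complex.exp (-Complex.I * (dot3 w ξ : ℂ)) * f (s, w) := by
  refine (f.integrable_slice s).bdd_mul (c := 1) ?_ (.of_forall fun w => ?_)
  · apply Continuous.aestronglyMeasurable
    unfold dot3
    fun_prop
  · rw [neg_mul, ← mul_neg, ← Complex.ofReal_neg, mul_comm Complex.I,
      Complex.norm_exp_ofReal_mul_I]

open scoped LineDeriv in
theorem FT3_lineDeriv_slice (f : 𝓢(ℝ × ℝ × ℝ × ℝ, ℂ)) (v : ℝ × ℝ × ℝ) (s : ℝ) (ξ : ℝ × ℝ × ℝ) :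
    FT3 (fun w => (∂_{((0 : ℝ), v)} f) (s, w)) ξ
      = Complex.I * (dot3 v ξ : ℂ) * FT3 (fun w => f (s, w)) ξ := by
  have hg (w : ℝ × ℝ × ℝ) : HasFDerivAt (fun w => f (s, w))
      ((fderiv ℝ f (s, w)).comp (ContinuousLinearMap.inr ℝ ℝ (ℝ × ℝ × ℝ))) w :=
    (f.differentiableAt (x := (s, w))).hasFDerivAt.comp w (hasFDerivAt_prodMk_right s w)
  have hg' (w : ℝ × ℝ × ℝ) : fderiv ℝ (fun w => f (s, w)) w v = (∂_{((0 : ℝ), v)} f) (s, w) := by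
    rw [(hg w).fderiv, SchwartzMap.lineDerivOp_apply_eq_fderiv]
    simp
  let L : ℝ × ℝ × ℝ →L[ℝ] ℝ := ξ.1 • ContinuousLinearMap.fst ℝ ℝ (ℝ × ℝ)
    + ξ.2.1 • (ContinuousLinearMap.fst ℝ ℝ ℝ).comp (ContinuousLinearMap.snd ℝ ℝ (ℝ × ℝ))
    + ξ.2.2 • (ContinuousLinearMap.snd ℝ ℝ ℝ).comp (ContinuousLinearMap.snd ℝ ℝ (ℝ × ℝ))
  have hL (w : ℝ × ℝ × ℝ) : L w = dot3 w ξ := by simp [L, dot3]; ring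
  have he (w : ℝ × ℝ × ℝ) : HasFDerivAt (fun w => Complex.exp (-Complex.I * (dot3 w ξ : ℂ)))
      (Complex.exp (-Complex.I * (dot3 w ξ : ℂ)) • (-Complex.I) • (Complex.ofRealCLM.comp L)) w := by
    have h1 := ((Complex.ofRealCLM.comp L).hasFDerivAt (x := w)).const_mul (-Complex.I)
    have := h1.cexp
    simpa [hL] using this
  have he' (w : ℝ × ℝ × ℝ) : fderiv ℝ (fun w => Complex.exp (-Complex.I * (dot3 w ξ : ℂ))) w v
      = -Complex.I * (dot3 v ξ : ℂ) * Complex.exp (-Complex.I * (dot3 w ξ : ℂ)) := by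
    rw [(he w).fderiv]
    simp [hL]; ring
  have : (volume : Measure (ℝ × ℝ × ℝ)).IsAddHaarMeasure :=
    have : (volume : Measure (ℝ × ℝ)).IsAddHaarMeasure :=
      Measure.prod.instIsAddHaarMeasure volume volume
    Measure.prod.instIsAddHaarMeasure volume volume
  have key := integral_mul_fderiv_eq_neg_fderiv_mul_of_integrable (μ := volume) (v := v)
    (f := fun w => Complex.exp (-Complex.I * (dot3 w ξ : ℂ))) (g := fun w => f (s, w))
    (by
      simp only [he', mul_assoc]
      exact ((integrable_exp_mul_slice f s ξ).const_mul _).const_mul _)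
    (by simp only [hg']; exact integrable_exp_mul_slice _ s ξ)
    (integrable_exp_mul_slice f s ξ)
    (fun w _ => (he w).differentiableAt) (fun w _ => (hg w).differentiableAt)
  simp only [hg', he', mul_assoc] at key
  rw [integral_const_mul, integral_const_mul] at key
  simp only [FT3]
  rw [key]
  ring

open scoped LineDeriv in
theorem exists_FT3_slice_eq_mul (f : 𝓢(ℝ × ℝ × ℝ × ℝ, ℂ)) (v : ℝ × ℝ × ℝ) :
    ∃ g : 𝓢(ℝ × ℝ × ℝ × ℝ, ℂ), ∀ s ξ, FT3 (fun w => g (s, w)) ξ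
      = (1 + (dot3 v ξ : ℂ) ^ 2) * FT3 (fun w => f (s, w)) ξ := by
  refine ⟨f - ∂_{((0 : ℝ), v)} (∂_{((0 : ℝ), v)} f), fun s ξ => ?_⟩
  have h1 := FT3_lineDeriv_slice (∂_{((0 : ℝ), v)} f) v s ξ
  rw [FT3_lineDeriv_slice f v s ξ] at h1
  have h2 : FT3 (fun w => (f - ∂_{((0 : ℝ), v)} (∂_{((0 : ℝ), v)} f)) (s, w)) ξ
      = FT3 (fun w => f (s, w)) ξ
        - FT3 (fun w => (∂_{((0 : ℝ), v)} (∂_{((0 : ℝ), v)} f)) (s, w)) ξ := by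
    simp only [FT3, sub_apply, mul_sub]
    rw [integral_sub (integrable_exp_mul_slice _ s ξ) (integrable_exp_mul_slice _ s ξ), mul_sub]
  rw [h2, h1]
  linear_combination (-(dot3 v ξ : ℂ) ^ 2 * FT3 (fun w => f (s, w)) ξ) * Complex.I_sq

open scoped LineDeriv in
theorem exists_norm_coord3_mul_FT3_slice_le (f : 𝓢(ℝ × ℝ × ℝ × ℝ, ℂ)) (j : Fin 3) :
    ∃ C : ℝ, 0 ≤ C ∧ ∀ s ξ, ‖(coord3 j ξ : ℂ) * FT3 (fun w => f (s, w)) ξ‖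
      ≤ C * (lorentz ξ.1 * (lorentz ξ.2.1 * lorentz ξ.2.2)) := by
  obtain ⟨v, hv⟩ : ∃ v : ℝ × ℝ × ℝ, ∀ ξ, dot3 v ξ = coord3 j ξ := by
    fin_cases j
    · exact ⟨(1, 0, 0), fun ξ => by simp [dot3, coord3]⟩
    · exact ⟨(0, 1, 0), fun ξ => by simp [dot3, coord3]⟩
    · exact ⟨(0, 0, 1), fun ξ => by simp [dot3, coord3]⟩
  obtain ⟨g₁, h₁⟩ := exists_FT3_slice_eq_mul (∂_{((0 : ℝ), v)} f) (1, 0, 0)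
  obtain ⟨g₂, h₂⟩ := exists_FT3_slice_eq_mul g₁ (0, 1, 0)
  obtain ⟨g₃, h₃⟩ := exists_FT3_slice_eq_mul g₂ (0, 0, 1)
  obtain ⟨C, hC, h⟩ := exists_norm_FT3_slice_le g₃
  refine ⟨C, hC, fun s ξ => ?_⟩
  have := h s ξ
  rw [h₃, h₂, h₁, FT3_lineDeriv_slice, hv, mul_assoc Complex.I] at this
  have e (r : ℝ) : ‖(1 + (r : ℂ) ^ 2)‖ = 1 + r ^ 2 := by
    rw [← Complex.ofReal_pow, ← Complex.ofReal_one, ← Complex.ofReal_add, Complex.norm_real,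
      Real.norm_of_nonneg (by positivity)]
  rw [norm_mul, norm_mul, norm_mul, norm_mul Complex.I, e, e, e, Complex.norm_I, one_mul] at this
  simp only [dot3, one_mul, zero_mul, add_zero, zero_add] at this
  simp only [lorentz]
  rw [← mul_inv, ← mul_inv, ← div_eq_mul_inv, le_div_iff₀ (by positivity)]
  linarith

/-- The truncation of a space-time function to the slab of times in `(0, t]`. -/
def slab (f : ℝ × ℝ × ℝ × ℝ → ℂ) (t : ℝ) (p : ℝ × ℝ × ℝ × ℝ) : ℂ :=
  (Set.Ioc 0 t).indicator (fun _ => f p) p.1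

theorem norm_slab_le (f : ℝ × ℝ × ℝ × ℝ → ℂ) (t : ℝ) (p : ℝ × ℝ × ℝ × ℝ) :
    ‖slab f t p‖ ≤ ‖f p‖ := norm_indicator_le_norm_self (fun _ => f p) p.1

theorem measurable_slab {f : ℝ × ℝ × ℝ × ℝ → ℂ} (hf : Measurable f) (t : ℝ) :
    Measurable (slab f t) := by
  have : slab f t = (Prod.fst ⁻¹' Set.Ioc 0 t).indicator f := by
    ext p
    simp [slab, Set.indicator]
  rw [this]
  exact hf.indicator (measurable_fst measurableSet_Ioc)

/-- The Fourier transform in the variables `(s, y, z)`, at fixed `x`, of the truncation of `f`. -/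
def slabFT (f : ℝ × ℝ × ℝ × ℝ → ℂ) (t x : ℝ) (q : ℝ × ℝ × ℝ) : ℂ :=
  ∫ p : ℝ × ℝ × ℝ, Complex.exp (Complex.I * ((-1 * (q.1 * p.1) : ℝ) : ℂ)) *
    (Complex.exp (Complex.I * ((-1 * (q.2.1 * p.2.1) : ℝ) : ℂ)) *
      Complex.exp (Complex.I * ((-1 * (q.2.2 * p.2.2) : ℝ) : ℂ))) * slab f t (p.1, x, p.2)

theorem measurable_slabFT {f : ℝ × ℝ × ℝ × ℝ → ℂ} (hf : Measurable f) (t : ℝ) :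
    Measurable fun p : ℝ × ℝ × ℝ × ℝ => slabFT f t p.1 p.2 := by
  apply StronglyMeasurable.measurable
  unfold slabFT
  apply StronglyMeasurable.integral_prod_right (f := fun (r : ℝ × ℝ × ℝ × ℝ) (p : ℝ × ℝ × ℝ) =>
    Complex.exp (Complex.I * ((-1 * (r.2.1 * p.1) : ℝ) : ℂ)) *
    (Complex.exp (Complex.I * ((-1 * (r.2.2.1 * p.2.1) : ℝ) : ℂ)) *
      Complex.exp (Complex.I * ((-1 * (r.2.2.2 * p.2.2) : ℝ) : ℂ))) * slab f t (p.1, r.1, p.2))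
  apply Measurable.stronglyMeasurable
  have h := (measurable_slab hf t).comp
    (f := fun q : (ℝ × ℝ × ℝ × ℝ) × (ℝ × ℝ × ℝ) => (q.2.1, q.1.1, q.2.2)) (by fun_prop)
  exact Measurable.mul (by fun_prop) h

theorem SchwartzMap.integrable_slab_slice (f : 𝓢(ℝ × ℝ × ℝ × ℝ, ℂ)) (t x : ℝ) :
    Integrable fun p : ℝ × ℝ × ℝ => slab f t (p.1, x, p.2) := by
  obtain ⟨C, hC, h⟩ := f.exists_norm_le_lorentz
  refine (integrable_lorentz3.const_mul (C * lorentz x)).mono'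
    ((measurable_slab f.continuous.measurable t).comp (by fun_prop)).aestronglyMeasurable
    (.of_forall fun p => ?_)
  refine (norm_slab_le _ _ _).trans ((h p.1 x p.2.1 p.2.2).trans (le_of_eq ?_))
  ring

theorem lintegral_enorm_slabFT_sq_le (f : 𝓢(ℝ × ℝ × ℝ × ℝ, ℂ)) (t x : ℝ) :
    ∫⁻ q, ‖slabFT f t x q‖ₑ ^ 2 ≤ ENNReal.ofReal ((2 * π) ^ 3) *
      ∫⁻ p : ℝ × ℝ × ℝ, ‖slab f t (p.1, x, p.2)‖ₑ ^ 2 := by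
  have hk := isL2Kernel_exp (σ := -1) (by simp)
  have h := (hk.prod (hk.prod hk)).bound (fun p => slab f t (p.1, x, p.2))
    ((measurable_slab f.continuous.measurable t).comp (by fun_prop)) (f.integrable_slab_slice t x)
  rw [← ENNReal.ofReal_mul (by positivity), ← ENNReal.ofReal_mul (by positivity)] at h
  rw [show (2 * π) ^ 3 = 2 * π * (2 * π * (2 * π)) by ring]
  exact h

theorem integral_reorder_of_le_lorentz {Φ : ℝ × ℝ × ℝ × ℝ → ℂ} {C : ℝ} (hΦ : Measurable Φ)
    (h : ∀ s x y z, ‖Φ (s, x, y, z)‖ ≤ C * (lorentz s * lorentz x * lorentz y * lorentz z)) :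
    ∫ x, ∫ p : ℝ × ℝ × ℝ, Φ (p.1, x, p.2) = ∫ s, ∫ w : ℝ × ℝ × ℝ, Φ (s, w) := by
  have hC : 0 ≤ C := by
    have := (norm_nonneg _).trans (h 0 0 0 0)
    simpa [lorentz] using this
  have i1 (x : ℝ) : Integrable fun p : ℝ × ℝ × ℝ => Φ (p.1, x, p.2) := by
    refine (integrable_lorentz3.const_mul (C * lorentz x)).mono'
      (hΦ.comp (by fun_prop)).aestronglyMeasurable (.of_forall fun p => ?_)
    exact (h p.1 x p.2.1 p.2.2).trans (le_of_eq (by ring))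
  have i2 (s : ℝ) : Integrable fun w : ℝ × ℝ × ℝ => Φ (s, w) := by
    refine (integrable_lorentz3.const_mul (C * lorentz s)).mono'
      (hΦ.comp (by fun_prop)).aestronglyMeasurable (.of_forall fun w => ?_)
    exact (h s w.1 w.2.1 w.2.2).trans (le_of_eq (by ring))
  have i3 : Integrable (Function.uncurry fun x s => ∫ v : ℝ × ℝ, Φ (s, x, v)) := by
    have hint : Integrable fun v : ℝ × ℝ => lorentz v.1 * lorentz v.2 :=
      integrable_lorentz.mul_prod integrable_lorentz
    refine ((integrable_lorentz.mul_prod integrable_lorentz).const_mul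
      (C * ∫ v : ℝ × ℝ, lorentz v.1 * lorentz v.2)).mono' ?_ (.of_forall fun q => ?_)
    · apply StronglyMeasurable.aestronglyMeasurable
      apply StronglyMeasurable.integral_prod_right
        (f := fun (q : ℝ × ℝ) (v : ℝ × ℝ) => Φ (q.2, q.1, v))
      exact (hΦ.comp (f := fun r : (ℝ × ℝ) × (ℝ × ℝ) => (r.1.2, r.1.1, r.2))
        (by fun_prop)).stronglyMeasurable
    · refine (norm_integral_le_of_norm_le (hint.const_mul (C * (lorentz q.1 * lorentz q.2)))
        (.of_forall fun v => ?_)).trans (le_of_eq ?_)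
      · exact (h q.2 q.1 v.1 v.2).trans (le_of_eq (by ring))
      · rw [integral_const_mul]; ring
  calc ∫ x, ∫ p : ℝ × ℝ × ℝ, Φ (p.1, x, p.2)
      = ∫ x, ∫ s, ∫ v : ℝ × ℝ, Φ (s, x, v) := by
        congr 1; ext x
        rw [Measure.volume_eq_prod ℝ (ℝ × ℝ), integral_prod _ (i1 x)]
    _ = ∫ s, ∫ x, ∫ v : ℝ × ℝ, Φ (s, x, v) := integral_integral_swap i3
    _ = ∫ s, ∫ w : ℝ × ℝ × ℝ, Φ (s, w) := by
        congr 1; ext s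
        rw [Measure.volume_eq_prod ℝ (ℝ × ℝ), integral_prod _ (i2 s)]

/-- The profile `∫₀ᵗ e^{-isω(ξ)} f̂(s, ξ) ds` of the Duhamel term on the frequency side. -/
def duhamelProfile (f : ℝ × ℝ × ℝ × ℝ → ℂ) (t : ℝ) (ξ : ℝ × ℝ × ℝ) : ℂ :=
  ∫ s in Set.Ioc 0 t, Complex.exp (Complex.I * ((-(s * omega3 ξ) : ℝ) : ℂ)) *
    FT3 (fun w => f (s, w)) ξ

theorem duhamelProfile_eq (f : 𝓢(ℝ × ℝ × ℝ × ℝ, ℂ)) (t : ℝ) (ξ : ℝ × ℝ × ℝ) :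
    duhamelProfile f t ξ = ((((2 * π) ^ 3)⁻¹ : ℝ) : ℂ) *
      ∫ x : ℝ, Complex.exp (Complex.I * ((-(x * ξ.1) : ℝ) : ℂ)) *
        slabFT f t x (omega3 ξ, ξ.2) := by
  obtain ⟨C, hC, h⟩ := f.exists_norm_le_lorentz
  set Φ : ℝ × ℝ × ℝ × ℝ → ℂ := fun p =>
    Complex.exp (Complex.I * ((-(p.1 * omega3 ξ + dot3 p.2 ξ) : ℝ) : ℂ)) * slab f t p with hΦ
  have hm : Measurable Φ := by
    refine Measurable.mul ?_ (measurable_slab f.continuous.measurable t)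
    unfold dot3
    fun_prop
  have hb (s x y z) : ‖Φ (s, x, y, z)‖ ≤ C * (lorentz s * lorentz x * lorentz y * lorentz z) := by
    rw [hΦ]
    dsimp only
    rw [norm_mul, mul_comm Complex.I, Complex.norm_exp_ofReal_mul_I, one_mul]
    exact (norm_slab_le _ _ _).trans (h s x y z)
  have h1 (x : ℝ) : Complex.exp (Complex.I * ((-(x * ξ.1) : ℝ) : ℂ)) *
      slabFT f t x (omega3 ξ, ξ.2) = ∫ p : ℝ × ℝ × ℝ, Φ (p.1, x, p.2) := by
    rw [slabFT, ← integral_const_mul]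
    congr 1; ext p
    simp only [hΦ, ← mul_assoc, ← Complex.exp_add, dot3]
    congr 2
    push_cast
    ring
  simp only [h1]
  rw [integral_reorder_of_le_lorentz hm hb, duhamelProfile, ← integral_indicator measurableSet_Ioc,
    ← integral_const_mul]
  congr 1; ext s
  by_cases hs : s ∈ Set.Ioc 0 t
  · rw [Set.indicator_of_mem hs, FT3, mul_left_comm, ← integral_const_mul]
    congr 2; ext w
    simp only [hΦ, slab, Set.indicator_of_mem hs, ← mul_assoc, ← Complex.exp_add]
    congr 2
    push_cast
    ring
  · simp [hΦ, slab, Set.indicator_of_notMem hs]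

theorem measurable_FT3_slice (f : 𝓢(ℝ × ℝ × ℝ × ℝ, ℂ)) :
    Measurable fun p : ℝ × ℝ × ℝ × ℝ => FT3 (fun w => f (p.1, w)) p.2 := by
  unfold FT3
  apply Measurable.const_mul
  apply StronglyMeasurable.measurable
  apply StronglyMeasurable.integral_prod_right (f := fun (p : ℝ × ℝ × ℝ × ℝ) (x : ℝ × ℝ × ℝ) =>
    Complex.exp (-Complex.I * (dot3 x p.2 : ℂ)) * f (p.1, x))
  apply Measurable.stronglyMeasurable
  have h := f.continuous.measurable.comp
    (f := fun q : (ℝ × ℝ × ℝ × ℝ) × (ℝ × ℝ × ℝ) => (q.1.1, q.2)) (by fun_prop)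
  refine Measurable.mul ?_ h
  simp only [dot3]
  fun_prop

theorem measurable_omega3 : Measurable omega3 := by unfold omega3; fun_prop

theorem measurable_coord3 (j : Fin 3) : Measurable (coord3 j) := by
  unfold coord3
  fin_cases j
  · exact measurable_fst
  · exact measurable_snd.fst
  · exact measurable_snd.snd

theorem measurable_duhamelProfile (f : 𝓢(ℝ × ℝ × ℝ × ℝ, ℂ)) (t : ℝ) :
    Measurable (duhamelProfile f t) := by
  apply StronglyMeasurable.measurable
  unfold duhamelProfile
  apply StronglyMeasurable.integral_prod_left (f := fun (s : ℝ) (ξ : ℝ × ℝ × ℝ) =>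
    Complex.exp (Complex.I * ((-(s * omega3 ξ) : ℝ) : ℂ)) * FT3 (fun w => f (s, w)) ξ)
  apply Measurable.stronglyMeasurable
  have := measurable_omega3
  exact Measurable.mul (by fun_prop) (measurable_FT3_slice f)

/-- The frequency-side symbol of the `j`-th component of the gradient of the Duhamel term. -/
def gradSymbol (j : Fin 3) (f : ℝ × ℝ × ℝ × ℝ → ℂ) (t : ℝ) (ξ : ℝ × ℝ × ℝ) : ℂ :=
  Complex.exp (Complex.I * ((t * omega3 ξ : ℝ) : ℂ)) *
    (Complex.I * (coord3 j ξ : ℂ) * duhamelProfile f t ξ)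

theorem norm_gradSymbol (j : Fin 3) (f : ℝ × ℝ × ℝ × ℝ → ℂ) (t : ℝ) (ξ : ℝ × ℝ × ℝ) :
    ‖gradSymbol j f t ξ‖ = |coord3 j ξ| * ‖duhamelProfile f t ξ‖ := by
  rw [gradSymbol, norm_mul, mul_comm Complex.I, Complex.norm_exp_ofReal_mul_I, norm_mul, norm_mul,
    Complex.norm_I, Complex.norm_real, Real.norm_eq_abs, one_mul, one_mul]

theorem measurable_gradSymbol (j : Fin 3) (f : 𝓢(ℝ × ℝ × ℝ × ℝ, ℂ)) (t : ℝ) :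
    Measurable (gradSymbol j f t) := by
  have := measurable_omega3
  have := measurable_coord3 j
  have := measurable_duhamelProfile f t
  unfold gradSymbol
  fun_prop

theorem integrable_duhamel_integrand (j : Fin 3) (f : 𝓢(ℝ × ℝ × ℝ × ℝ, ℂ)) (t : ℝ)
    (x : ℝ × ℝ × ℝ) :
    Integrable (Function.uncurry fun (s : ℝ) (ξ : ℝ × ℝ × ℝ) =>
      Complex.exp (Complex.I * ((dot3 x ξ + (t - s) * omega3 ξ : ℝ) : ℂ)) *
        (Complex.I * (coord3 j ξ : ℂ)) * FT3 (fun w => f (s, w)) ξ)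
      ((volume.restrict (Set.Ioc 0 t)).prod volume) := by
  obtain ⟨C, hC, h⟩ := exists_norm_coord3_mul_FT3_slice_le f j
  have hc : Integrable (fun _ : ℝ => (1 : ℝ)) (volume.restrict (Set.Ioc 0 t)) :=
    integrable_const _
  refine ((hc.mul_prod integrable_lorentz3).const_mul C).mono' ?_ (.of_forall fun ⟨s, ξ⟩ => ?_)
  · apply Measurable.aestronglyMeasurable
    have := measurable_omega3
    have := measurable_coord3 j
    refine Measurable.mul ?_ (measurable_FT3_slice f)
    unfold dot3
    fun_prop
  · have := h s ξ
    simp only [Function.uncurry]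
    rw [mul_assoc, norm_mul, mul_comm Complex.I ((_ : ℝ) : ℂ), Complex.norm_exp_ofReal_mul_I,
      one_mul, mul_assoc, norm_mul, Complex.norm_I, one_mul, one_mul]
    exact this

theorem duhamel_eq_integral_gradSymbol (j : Fin 3) (f : 𝓢(ℝ × ℝ × ℝ × ℝ, ℂ)) {t : ℝ} (ht : 0 ≤ t)
    (x : ℝ × ℝ × ℝ) :
    duhamel (fun ξ => Complex.I * (coord3 j ξ : ℂ)) f t x
      = ∫ ξ, Complex.exp (Complex.I * (dot3 x ξ : ℂ)) * gradSymbol j f t ξ := by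
  rw [duhamel, intervalIntegral.integral_of_le ht,
    integral_integral_swap (integrable_duhamel_integrand j f t x)]
  congr 1; ext ξ
  rw [gradSymbol, duhamelProfile, ← integral_const_mul, ← integral_const_mul, ← integral_const_mul]
  congr 1; ext s
  have : Complex.exp (Complex.I * ((dot3 x ξ + (t - s) * omega3 ξ : ℝ) : ℂ))
      = Complex.exp (Complex.I * (dot3 x ξ : ℂ)) * Complex.exp (Complex.I * ((t * omega3 ξ : ℝ) : ℂ))
        * Complex.exp (Complex.I * ((-(s * omega3 ξ) : ℝ) : ℂ)) := by
    rw [← Complex.exp_add, ← Complex.exp_add]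
    congr 1
    push_cast
    ring
  rw [this]
  ring

theorem integrable_gradSymbol (j : Fin 3) (f : 𝓢(ℝ × ℝ × ℝ × ℝ, ℂ)) (t : ℝ) :
    Integrable (gradSymbol j f t) := by
  have h := (integrable_duhamel_integrand j f t 0).integral_prod_right
  refine h.congr (.of_forall fun ξ => ?_)
  simp only [Function.uncurry]
  rw [gradSymbol, duhamelProfile, ← integral_const_mul, ← integral_const_mul]
  congr 1; ext s
  have : Complex.exp (Complex.I * ((dot3 0 ξ + (t - s) * omega3 ξ : ℝ) : ℂ))
      = Complex.exp (Complex.I * ((t * omega3 ξ : ℝ) : ℂ))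
        * Complex.exp (Complex.I * ((-(s * omega3 ξ) : ℝ) : ℂ)) := by
    rw [← Complex.exp_add]
    congr 1
    simp only [dot3, Prod.fst_zero, Prod.snd_zero]
    push_cast
    ring
  rw [this]
  ring

theorem lintegral_enorm_duhamel_sq_le (j : Fin 3) (f : 𝓢(ℝ × ℝ × ℝ × ℝ, ℂ)) {t : ℝ} (ht : 0 ≤ t) :
    ∫⁻ x, ‖duhamel (fun ξ => Complex.I * (coord3 j ξ : ℂ)) f t x‖ₑ ^ 2
      ≤ ENNReal.ofReal ((2 * π) ^ 3) * ∫⁻ ξ, ‖gradSymbol j f t ξ‖ₑ ^ 2 := by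
  have hk := isL2Kernel_exp (σ := 1) (by simp)
  have h := (hk.prod (hk.prod hk)).bound _ (measurable_gradSymbol j f t)
    (integrable_gradSymbol j f t)
  rw [← ENNReal.ofReal_mul (by positivity), ← ENNReal.ofReal_mul (by positivity)] at h
  rw [show (2 * π) ^ 3 = 2 * π * (2 * π * (2 * π)) by ring]
  simp only [duhamel_eq_integral_gradSymbol j f ht]
  refine le_trans (le_of_eq ?_) h
  congr 1; ext x
  congr 3; ext ξ
  rw [← Complex.exp_add, ← Complex.exp_add]
  congr 2
  simp only [dot3]
  push_cast
  ring

theorem sum_coord3_sq (ξ : ℝ × ℝ × ℝ) : ∑ j : Fin 3, coord3 j ξ ^ 2 = dot3 ξ ξ := by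
  simp [Fin.sum_univ_three, coord3, dot3]
  ring

theorem dot3_self_nonneg (ξ : ℝ × ℝ × ℝ) : 0 ≤ dot3 ξ ξ := by
  rw [← sum_coord3_sq]
  positivity

theorem measurable_dot3_self : Measurable fun ξ : ℝ × ℝ × ℝ => dot3 ξ ξ := by
  unfold dot3
  fun_prop

theorem sum_enorm_gradSymbol_sq (f : ℝ × ℝ × ℝ × ℝ → ℂ) (t : ℝ) (ξ : ℝ × ℝ × ℝ) :
    ∑ j : Fin 3, ‖gradSymbol j f t ξ‖ₑ ^ 2
      = ENNReal.ofReal (dot3 ξ ξ) * ‖duhamelProfile f t ξ‖ₑ ^ 2 := by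
  have h (j : Fin 3) : ‖gradSymbol j f t ξ‖ₑ ^ 2
      = ENNReal.ofReal (coord3 j ξ ^ 2) * ‖duhamelProfile f t ξ‖ₑ ^ 2 := by
    rw [← ofReal_norm, norm_gradSymbol, ENNReal.ofReal_mul (abs_nonneg _), mul_pow,
      ← ENNReal.ofReal_pow (abs_nonneg _), sq_abs, ofReal_norm]
  simp only [h]
  rw [← Finset.sum_mul, ← ENNReal.ofReal_sum_of_nonneg (fun _ _ => sq_nonneg _), sum_coord3_sq]

theorem enorm_duhamelProfile_le (f : 𝓢(ℝ × ℝ × ℝ × ℝ, ℂ)) (t : ℝ) (ξ : ℝ × ℝ × ℝ) :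
    ‖duhamelProfile f t ξ‖ₑ ≤ ENNReal.ofReal (((2 * π) ^ 3)⁻¹) *
      ∫⁻ x : ℝ, ‖slabFT f t x (omega3 ξ, ξ.2)‖ₑ := by
  rw [duhamelProfile_eq, enorm_mul, ← ofReal_norm, Complex.norm_real,
    Real.norm_of_nonneg (by positivity)]
  refine mul_le_mul' le_rfl ((enorm_integral_le_lintegral_enorm _).trans (le_of_eq ?_))
  congr 1; ext x
  rw [enorm_mul, ← ofReal_norm (Complex.exp _), mul_comm Complex.I, Complex.norm_exp_ofReal_mul_I,
    ENNReal.ofReal_one, one_mul]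

theorem lintegral_dot3_mul_slabFT_sq_le (f : 𝓢(ℝ × ℝ × ℝ × ℝ, ℂ)) (t x : ℝ) :
    ∫⁻ ξ : ℝ × ℝ × ℝ, ENNReal.ofReal (dot3 ξ ξ) * ‖slabFT f t x (omega3 ξ, ξ.2)‖ₑ ^ 2
      ≤ ∫⁻ q, ‖slabFT f t x q‖ₑ ^ 2 := by
  have hG : Measurable (slabFT f t x) :=
    (measurable_slabFT f.continuous.measurable t).comp
      (f := fun q : ℝ × ℝ × ℝ => (x, q)) (by fun_prop)
  have hω := measurable_omega3
  have hd := measurable_dot3_self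
  rw [Measure.volume_eq_prod, lintegral_prod_symm', lintegral_prod_symm']
  · exact lintegral_mono fun q =>
      lintegral_dot3_mul_comp_omega3_le (fun τ => ‖slabFT f t x (τ, q)‖ₑ ^ 2) q
  · fun_prop
  · fun_prop

theorem lintegral_dot3_mul_duhamelProfile_sq_le (f : 𝓢(ℝ × ℝ × ℝ × ℝ, ℂ)) (t : ℝ) :
    ∫⁻ ξ, ENNReal.ofReal (dot3 ξ ξ) * ‖duhamelProfile f t ξ‖ₑ ^ 2
      ≤ ENNReal.ofReal (((2 * π) ^ 3)⁻¹) *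
        (∫⁻ x, (∫⁻ p : ℝ × ℝ × ℝ, ‖slab f t (p.1, x, p.2)‖ₑ ^ 2) ^ (1 / 2 : ℝ)) ^ 2 := by
  set c := ENNReal.ofReal (((2 * π) ^ 3)⁻¹) with hc
  set κ := ENNReal.ofReal ((2 * π) ^ 3) with hκ
  have hcκ : c ^ 2 * κ = c := by
    rw [hc, hκ, ← ENNReal.ofReal_pow (by positivity), ← ENNReal.ofReal_mul (by positivity)]
    congr 1
    field_simp
  set F : ℝ → ℝ × ℝ × ℝ → ℝ≥0∞ := fun x ξ =>
    ENNReal.ofReal (√(dot3 ξ ξ)) * ‖slabFT f t x (omega3 ξ, ξ.2)‖ₑ with hF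
  have hω := measurable_omega3
  have hd := measurable_dot3_self
  have hS := (measurable_slabFT f.continuous.measurable t).comp
    (f := fun q : ℝ × (ℝ × ℝ × ℝ) => (q.1, omega3 q.2, q.2.2)) (by fun_prop)
  have hFm : Measurable (Function.uncurry F) := by
    refine Measurable.mul ?_ hS.enorm
    exact (hd.comp measurable_snd).sqrt.ennreal_ofReal
  have hF2 (x : ℝ) : ∫⁻ ξ, F x ξ ^ 2 ≤ κ * ∫⁻ p : ℝ × ℝ × ℝ, ‖slab f t (p.1, x, p.2)‖ₑ ^ 2 := by
    refine le_trans (le_of_eq ?_) ((lintegral_dot3_mul_slabFT_sq_le f t x).trans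
      (lintegral_enorm_slabFT_sq_le f t x))
    congr 1; ext ξ
    rw [hF]
    dsimp only
    rw [mul_pow, ← ENNReal.ofReal_pow (Real.sqrt_nonneg _), Real.sq_sqrt (dot3_self_nonneg ξ)]
  calc ∫⁻ ξ, ENNReal.ofReal (dot3 ξ ξ) * ‖duhamelProfile f t ξ‖ₑ ^ 2
      ≤ ∫⁻ ξ, c ^ 2 * (∫⁻ x, F x ξ) ^ 2 := by
        refine lintegral_mono fun ξ => ?_
        have h1 : ∫⁻ x, F x ξ
            = ENNReal.ofReal (√(dot3 ξ ξ)) * ∫⁻ x, ‖slabFT f t x (omega3 ξ, ξ.2)‖ₑ :=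
          lintegral_const_mul' _ _ ENNReal.ofReal_ne_top
        rw [h1, mul_pow, ← ENNReal.ofReal_pow (Real.sqrt_nonneg _),
          Real.sq_sqrt (dot3_self_nonneg ξ), mul_left_comm, ← mul_pow]
        gcongr
        exact enorm_duhamelProfile_le f t ξ
    _ = c ^ 2 * ∫⁻ ξ, (∫⁻ x, F x ξ) ^ 2 :=
        lintegral_const_mul' _ _ (ENNReal.pow_ne_top ENNReal.ofReal_ne_top)
    _ ≤ c ^ 2 * (∫⁻ x, (∫⁻ ξ, F x ξ ^ 2) ^ (1 / 2 : ℝ)) ^ 2 := by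
        gcongr
        exact lintegral_sq_lintegral_le hFm
    _ ≤ c ^ 2 * (∫⁻ x, κ ^ (1 / 2 : ℝ) *
          (∫⁻ p : ℝ × ℝ × ℝ, ‖slab f t (p.1, x, p.2)‖ₑ ^ 2) ^ (1 / 2 : ℝ)) ^ 2 := by
        gcongr with x
        rw [← ENNReal.mul_rpow_of_nonneg _ _ (by norm_num)]
        gcongr
        exact hF2 x
    _ = c * (∫⁻ x, (∫⁻ p : ℝ × ℝ × ℝ, ‖slab f t (p.1, x, p.2)‖ₑ ^ 2) ^ (1 / 2 : ℝ)) ^ 2 := by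
        rw [lintegral_const_mul' _ _ (by simp [hκ]), mul_pow, ← ENNReal.rpow_natCast (κ ^ _),
          ← ENNReal.rpow_mul, ← mul_assoc]
        norm_num [hcκ]

theorem lintegral_sum_enorm_duhamel_sq_le (f : 𝓢(ℝ × ℝ × ℝ × ℝ, ℂ)) {t : ℝ} (ht : 0 ≤ t) :
    ∫⁻ x, ‖∑ j : Fin 3, ‖duhamel (fun ξ => Complex.I * (coord3 j ξ : ℂ)) f t x‖ ^ 2‖ₑ
      ≤ (∫⁻ x, (∫⁻ p : ℝ × ℝ × ℝ, ‖slab f t (p.1, x, p.2)‖ₑ ^ 2) ^ (1 / 2 : ℝ)) ^ 2 := by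
  set D : Fin 3 → ℝ × ℝ × ℝ → ℂ := fun j x =>
    duhamel (fun ξ => Complex.I * (coord3 j ξ : ℂ)) f t x with hD
  have hDm (j : Fin 3) : Measurable (D j) := by
    rw [hD]
    simp only [duhamel_eq_integral_gradSymbol j f ht]
    apply StronglyMeasurable.measurable
    apply StronglyMeasurable.integral_prod_right (f := fun (x ξ : ℝ × ℝ × ℝ) =>
      Complex.exp (Complex.I * (dot3 x ξ : ℂ)) * gradSymbol j f t ξ)
    apply Measurable.stronglyMeasurable
    refine Measurable.mul ?_ ((measurable_gradSymbol j f t).comp measurable_snd)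
    unfold dot3
    fun_prop
  calc ∫⁻ x, ‖∑ j : Fin 3, ‖D j x‖ ^ 2‖ₑ
      = ∫⁻ x, ∑ j : Fin 3, ‖D j x‖ₑ ^ 2 := by
        congr 1; ext x
        rw [Real.enorm_of_nonneg (by positivity),
          ENNReal.ofReal_sum_of_nonneg (fun _ _ => by positivity)]
        simp only [ENNReal.ofReal_pow (norm_nonneg _), ofReal_norm]
    _ = ∑ j : Fin 3, ∫⁻ x, ‖D j x‖ₑ ^ 2 :=
        lintegral_finsetSum _ fun j _ => (hDm j).enorm.pow_const 2
    _ ≤ ∑ j : Fin 3, ENNReal.ofReal ((2 * π) ^ 3) * ∫⁻ ξ, ‖gradSymbol j f t ξ‖ₑ ^ 2 :=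
        Finset.sum_le_sum fun j _ => lintegral_enorm_duhamel_sq_le j f ht
    _ = ENNReal.ofReal ((2 * π) ^ 3) *
          ∫⁻ ξ, ENNReal.ofReal (dot3 ξ ξ) * ‖duhamelProfile f t ξ‖ₑ ^ 2 := by
        rw [← Finset.mul_sum,
          ← lintegral_finsetSum _ fun j _ => (measurable_gradSymbol j f t).enorm.pow_const 2]
        simp only [sum_enorm_gradSymbol_sq]
    _ ≤ ENNReal.ofReal ((2 * π) ^ 3) * (ENNReal.ofReal (((2 * π) ^ 3)⁻¹) *
        (∫⁻ x, (∫⁻ p : ℝ × ℝ × ℝ, ‖slab f t (p.1, x, p.2)‖ₑ ^ 2) ^ (1 / 2 : ℝ)) ^ 2) := by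
        gcongr
        exact lintegral_dot3_mul_duhamelProfile_sq_le f t
    _ = _ := by
        rw [← mul_assoc, ← ENNReal.ofReal_mul (by positivity),
          mul_inv_cancel₀ (by positivity), ENNReal.ofReal_one, one_mul]

theorem lintegral_slab_le (f : 𝓢(ℝ × ℝ × ℝ × ℝ, ℂ)) {t T : ℝ} (ht : t ≤ T) :
    ∫⁻ x, (∫⁻ p : ℝ × ℝ × ℝ, ‖slab f t (p.1, x, p.2)‖ₑ ^ 2) ^ (1 / 2 : ℝ)
      ≤ ENNReal.ofReal (∫ x : ℝ, √(∫ s in Set.Ioc (0 : ℝ) T, ∫ y : ℝ, ∫ z : ℝ,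
          ‖f (s, x, y, z)‖ ^ 2)) := by
  obtain ⟨C, hC, h⟩ := f.exists_norm_le_lorentz
  have hsq (p : ℝ × ℝ × ℝ) (x : ℝ) : ‖f (p.1, x, p.2)‖ ^ 2
      ≤ (C * lorentz x) ^ 2 * (lorentz p.1 * (lorentz p.2.1 * lorentz p.2.2)) := by
    have h1 := lorentz_pos p.1
    have h2 := lorentz_pos p.2.1
    have h3 := lorentz_pos p.2.2
    have h4 : lorentz p.1 * (lorentz p.2.1 * lorentz p.2.2) ≤ 1 :=
      mul_le_one₀ (lorentz_le_one _) (by positivity)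
        (mul_le_one₀ (lorentz_le_one _) h3.le (lorentz_le_one _))
    calc ‖f (p.1, x, p.2)‖ ^ 2
        ≤ (C * (lorentz p.1 * lorentz x * lorentz p.2.1 * lorentz p.2.2)) ^ 2 := by
          gcongr
          exact h p.1 x p.2.1 p.2.2
      _ = (C * lorentz x) ^ 2 * (lorentz p.1 * (lorentz p.2.1 * lorentz p.2.2)) *
          (lorentz p.1 * (lorentz p.2.1 * lorentz p.2.2)) := by ring
      _ ≤ _ := mul_le_of_le_one_right (by positivity) h4
  have hint (x : ℝ) : Integrable fun p : ℝ × ℝ × ℝ => ‖f (p.1, x, p.2)‖ ^ 2 := by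
    refine (integrable_lorentz3.const_mul ((C * lorentz x) ^ 2)).mono'
      (Continuous.aestronglyMeasurable ?_) (.of_forall fun p => ?_)
    · have := f.continuous
      fun_prop
    · rw [Real.norm_of_nonneg (by positivity)]
      exact hsq p x
  have hint2 (x s : ℝ) : Integrable fun v : ℝ × ℝ => ‖f (s, x, v)‖ ^ 2 := by
    refine ((integrable_lorentz.mul_prod integrable_lorentz).const_mul
      ((C * lorentz x) ^ 2 * lorentz s)).mono'
      (Continuous.aestronglyMeasurable ?_) (.of_forall fun v => ?_)
    · have := f.continuous
      fun_prop
    · rw [Real.norm_of_nonneg (by positivity)]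
      exact (hsq (s, v) x).trans (le_of_eq (by ring))
  set J : ℝ → ℝ := fun x => ∫ p in Set.Ioc (0 : ℝ) T ×ˢ (Set.univ : Set (ℝ × ℝ)),
    ‖f (p.1, x, p.2)‖ ^ 2 with hJ
  have hJ_eq (x : ℝ) : ∫ s in Set.Ioc (0 : ℝ) T, ∫ y : ℝ, ∫ z : ℝ, ‖f (s, x, y, z)‖ ^ 2 = J x := by
    rw [hJ]
    dsimp only
    rw [Measure.volume_eq_prod, setIntegral_prod _ (hint x).integrableOn]
    congr 1; ext s
    rw [Measure.restrict_univ, Measure.volume_eq_prod, integral_prod _ (hint2 x s)]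
  simp only [hJ_eq]
  have hms : MeasurableSet (Set.Ioc (0 : ℝ) T ×ˢ (Set.univ : Set (ℝ × ℝ))) :=
    measurableSet_Ioc.prod .univ
  have hpt (x : ℝ) : (∫⁻ p : ℝ × ℝ × ℝ, ‖slab f t (p.1, x, p.2)‖ₑ ^ 2) ^ (1 / 2 : ℝ)
      ≤ ENNReal.ofReal (√(J x)) := by
    rw [Real.sqrt_eq_rpow, ← ENNReal.ofReal_rpow_of_nonneg
      (integral_nonneg fun p => by positivity) (by norm_num)]
    gcongr
    rw [ofReal_integral_eq_lintegral_ofReal (hint x).integrableOn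
      (.of_forall fun p => by positivity), ← lintegral_indicator hms]
    refine lintegral_mono fun p => ?_
    by_cases hp : p.1 ∈ Set.Ioc 0 t
    · have hpT : p ∈ Set.Ioc (0 : ℝ) T ×ˢ (Set.univ : Set (ℝ × ℝ)) :=
        ⟨⟨hp.1, hp.2.trans ht⟩, Set.mem_univ _⟩
      rw [Set.indicator_of_mem hpT,
        ENNReal.ofReal_pow (norm_nonneg _), ofReal_norm, slab, Set.indicator_of_mem hp]
    · simp [slab, Set.indicator_of_notMem hp]
  have hJm : Measurable J := by
    apply StronglyMeasurable.measurable
    apply StronglyMeasurable.integral_prod_right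
      (f := fun (x : ℝ) (p : ℝ × ℝ × ℝ) => ‖f (p.1, x, p.2)‖ ^ 2)
    apply Continuous.stronglyMeasurable
    have := f.continuous
    unfold Function.uncurry
    fun_prop
  have hJint : Integrable fun x => √(J x) := by
    set B := ∫ p in Set.Ioc (0 : ℝ) T ×ˢ (Set.univ : Set (ℝ × ℝ)),
      lorentz p.1 * (lorentz p.2.1 * lorentz p.2.2)
    refine ((integrable_lorentz.const_mul C).mul_const (√B)).mono'
      hJm.sqrt.aestronglyMeasurable (.of_forall fun x => ?_)
    rw [Real.norm_of_nonneg (Real.sqrt_nonneg _)]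
    have hx : 0 ≤ C * lorentz x := mul_nonneg hC (lorentz_pos x).le
    calc √(J x) ≤ √((C * lorentz x) ^ 2 * B) := by
          gcongr
          rw [hJ]
          dsimp only
          rw [← integral_const_mul]
          exact integral_mono (hint x).integrableOn
            (integrable_lorentz3.const_mul _).integrableOn fun p => hsq p x
      _ = C * lorentz x * √B := by
          rw [Real.sqrt_mul (by positivity), Real.sqrt_sq hx]
  calc ∫⁻ x, (∫⁻ p : ℝ × ℝ × ℝ, ‖slab f t (p.1, x, p.2)‖ₑ ^ 2) ^ (1 / 2 : ℝ)
      ≤ ∫⁻ x, ENNReal.ofReal (√(J x)) := lintegral_mono hpt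
    _ = _ := (ofReal_integral_eq_lintegral_ofReal hJint
        (.of_forall fun x => Real.sqrt_nonneg _)).symm

/-- Estimate (est-nhgroup): ‖∇∫₀^t U(t-t')f(t')dt'‖_{L^∞_T L²_x̄} ≲ ‖f‖_{L¹_x L²_{yzT}}. -/
theorem duhamel_grad_LinfT_L2 :
    ∃ C : ℝ, 0 < C ∧ ∀ T : ℝ, 0 < T → ∀ f : SchwartzMap (ℝ × ℝ × ℝ × ℝ) ℂ,
      (⨆ t : Set.Icc (0:ℝ) T,
        Real.sqrt (∫ x : ℝ × ℝ × ℝ,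
          ∑ j : Fin 3, ‖duhamel (fun ξ => Complex.I * (coord3 j ξ : ℂ)) (⇑f) (t : ℝ) x‖ ^ 2))
      ≤ C * ∫ x : ℝ, Real.sqrt (∫ t in Set.Ioc (0:ℝ) T, ∫ y : ℝ, ∫ z : ℝ,
          ‖f (t, x, y, z)‖ ^ 2) := by
  refine ⟨1, one_pos, fun T _ f => ?_⟩
  rw [one_mul]
  have hR : 0 ≤ ∫ x : ℝ, √(∫ t in Set.Ioc (0:ℝ) T, ∫ y : ℝ, ∫ z : ℝ, ‖f (t, x, y, z)‖ ^ 2) :=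
    integral_nonneg fun x => Real.sqrt_nonneg _
  refine Real.iSup_le (fun t => ?_) hR
  rw [Real.sqrt_le_left hR, ← ENNReal.ofReal_le_ofReal_iff (sq_nonneg _), ENNReal.ofReal_pow hR]
  calc ENNReal.ofReal (∫ x : ℝ × ℝ × ℝ,
        ∑ j : Fin 3, ‖duhamel (fun ξ => Complex.I * (coord3 j ξ : ℂ)) (⇑f) (t : ℝ) x‖ ^ 2)
      ≤ ∫⁻ x : ℝ × ℝ × ℝ,
        ‖∑ j : Fin 3, ‖duhamel (fun ξ => Complex.I * (coord3 j ξ : ℂ)) (⇑f) (t : ℝ) x‖ ^ 2‖ₑ := by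
        refine le_trans ?_ (enorm_integral_le_lintegral_enorm _)
        exact Real.ofReal_le_enorm _
    _ ≤ _ := lintegral_sum_enorm_duhamel_sq_le f t.2.1
    _ ≤ _ := by
        gcongr
        exact lintegral_slab_le f t.2.2
end
end
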